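/- arXiv:1611.01251 — 2 statements merged into one kernel-verified Lean document; each statement's English description precedes it below -/
import Mathlib

section
/- Let F be a field, let d_1 ≥ d_2 ≥ ⋯ ≥ d_n ≥ 0 be integers, and let x^d = x_1^{d_1}⋯x_n^{d_n} ∈ F[x_1,…,x_n]. Let w ∈ S_n be a permutation with Des(w) ⊆ Des(d) := {j ∈ [n−1] : d_j > d_{j+1}}. Then for any reduced word w = s_{i_1}⋯s_{i_ℓ} of w, the polynomial π̄_{i_1}(π̄_{i_2}(⋯π̄_{i_ℓ}(x^d)⋯)) is nonzero and its neglex-leading term is the monomial w(x^d) = x_{w(1)}^{d_1}⋯x_{w(n)}^{d_n}, appearing with coefficient 1. -/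
open scoped Classical
open MvPolynomial

noncomputable section

namespace OSPHecke

/-- Stirling numbers of the second kind. -/
def stirling : ℕ → ℕ → ℕ
  | 0, 0 => 1
  | 0, _ + 1 => 0
  | _ + 1, 0 => 0
  | n + 1, k + 1 => stirling n k + (k + 1) * stirling n (k + 1)

/-- The `q`-analogue `[k]_q = 1 + q + ⋯ + q^{k-1}` as a polynomial in `q` over `ℕ`. -/
def qnat (k : ℕ) : Polynomial ℕ := ∑ t ∈ Finset.range k, Polynomial.X ^ t

/-- The `q`-factorial `[k]!_q`. -/
def qfact : ℕ → Polynomial ℕ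
  | 0 => 1
  | k + 1 => qnat (k + 1) * qfact k

/-- The `q`-Stirling numbers `Stir_q(n,k)`, defined by
`Stir_q(n,k) = Stir_q(n-1,k-1) + [k]_q · Stir_q(n-1,k)` and `Stir_q(0,k) = δ_{0,k}`. -/
def qstirling : ℕ → ℕ → Polynomial ℕ
  | 0, 0 => 1
  | 0, _ + 1 => 0
  | _ + 1, 0 => 0
  | n + 1, k + 1 => qstirling n k + qnat (k + 1) * qstirling n (k + 1)

variable (F : Type*) [Field F]

/-- The complete homogeneous symmetric polynomial of degree `d` in the first `m`
variables `x_1, …, x_m` of `F[x_1, …, x_n]` (variables are 0-indexed). -/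
def hpoly (n d m : ℕ) : MvPolynomial (Fin n) F :=
  ∑ s ∈ Finset.univ.filter (fun s : Sym (Fin n) d => ∀ j ∈ s.1, (j : ℕ) < m),
    (s.1.map MvPolynomial.X).prod

/-- The ideal `J_{n,k}` generated by `h_k(x_1), h_k(x_1,x_2), …, h_k(x_1,…,x_n)` and
`e_n(x_n), e_{n-1}(x_n), …, e_{n-k+1}(x_n)`. -/
def Jideal (n k : ℕ) : Ideal (MvPolynomial (Fin n) F) :=
  Ideal.span ({f | ∃ m, 1 ≤ m ∧ m ≤ n ∧ f = hpoly F n k m} ∪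
    {f | ∃ d, n - k < d ∧ d ≤ n ∧ f = MvPolynomial.esymm (Fin n) F d})

/-- The neglex order on exponent vectors: `a < b` iff there is a position `j` with
`a j < b j` and `a l = b l` for all `l > j`. -/
def NeglexLt {n : ℕ} (a b : Fin n → ℕ) : Prop :=
  ∃ j : Fin n, a j < b j ∧ ∀ l, j < l → a l = b l

/-- The value `w(t+1)` of a permutation at the 1-based position `t+1`
(0-based position `t`); extended by `0` outside the range. -/
def permVal {n : ℕ} (w : Equiv.Perm (Fin n)) (t : ℕ) : ℕ :=
  if h : t < n then (w ⟨t, h⟩ : ℕ) else 0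

/-- The descent set of a permutation, recorded 1-based:
`Des(w) = {j ∈ [n-1] : w(j) > w(j+1)}`. -/
def permDes {n : ℕ} (w : Equiv.Perm (Fin n)) : Finset ℕ :=
  (Finset.Ico 1 n).filter fun j => permVal w j < permVal w (j - 1)

/-- The inversion number (= Coxeter length) of a permutation. -/
def invCount {n : ℕ} (w : Equiv.Perm (Fin n)) : ℕ :=
  ((Finset.univ : Finset (Fin n × Fin n)).filter fun p => p.1 < p.2 ∧ w p.2 < w p.1).card

/-- The descent set (1-based) of a sequence `i = (i_1, i_2, …)`, given 0-based as
`i : ℕ → ℕ`: `Des(i) = {j ∈ [n-1] : i_j > i_{j+1}}`. -/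
def seqDes (n : ℕ) (i : ℕ → ℕ) : Finset ℕ :=
  (Finset.Ico 1 n).filter fun j => i j < i (j - 1)

/-- `α` is a composition of `n`. -/
def IsComposition (n : ℕ) (α : List ℕ) : Prop := α.sum = n ∧ ∀ a ∈ α, 0 < a

/-- The descent set of a composition: the partial sums `α_1, α_1+α_2, …`
excluding the total sum. -/
def desComp (α : List ℕ) : Finset ℕ :=
  ((Finset.range α.length).filter fun t => 0 < t).image fun t => (α.take t).sum

/-- The variable `x_{t+1}` (0-based index `t`), extended by `0` out of range. -/
def Xv (n : ℕ) (t : ℕ) : MvPolynomial (Fin n) F :=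
  if h : t < n then MvPolynomial.X ⟨t, h⟩ else 0

/-- The adjacent transposition exchanging the 0-based indices `t` and `t+1`. -/
def adjSwap (n t : ℕ) : Equiv.Perm (Fin n) :=
  if h : t + 1 < n then Equiv.swap ⟨t, Nat.lt_of_succ_lt h⟩ ⟨t + 1, h⟩ else 1

/-- `PibarRel F n t f g` says that `g = π̄_t(f)`, where (0-based indices `t`, `t+1`)
`π̄_t(f) = (x_{t+1}·(f - s_t(f)))/(x_t - x_{t+1}) = π_t(f) - f`; since `F[x]` is an
integral domain such a `g` is unique when it exists (and it always exists). -/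
def PibarRel (n t : ℕ) (f g : MvPolynomial (Fin n) F) : Prop :=
  (Xv F n t - Xv F n (t + 1)) * g =
    Xv F n (t + 1) * (f - MvPolynomial.rename (⇑(adjSwap n t)) f)

/-- The permutation associated to a word of (0-based) adjacent transposition indices. -/
def wordPerm (n : ℕ) (L : List ℕ) : Equiv.Perm (Fin n) := (L.map (adjSwap n)).prod

/-- `L` is a reduced word for `w`. -/
def IsReducedWord (n : ℕ) (L : List ℕ) (w : Equiv.Perm (Fin n)) : Prop :=
  (∀ t ∈ L, t + 1 < n) ∧ wordPerm n L = w ∧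
    ∀ L' : List ℕ, (∀ t ∈ L', t + 1 < n) → wordPerm n L' = w → L.length ≤ L'.length

/-- `g` is a chain of successive applications of the operators `π̄` along the word `L`,
applied right-to-left (so `g (t+1) = π̄_{L.reverse[t]} (g t)`). -/
def PibarChain (n : ℕ) (L : List ℕ) (g : ℕ → MvPolynomial (Fin n) F) : Prop :=
  ∀ t, t < L.length → PibarRel F n (L.reverse.getD t 0) (g t) (g (t + 1))

/-- `p = π̄_w(f)`, computed along some reduced word for `w`. -/
def IsPibarApplied (n : ℕ) (w : Equiv.Perm (Fin n)) (f p : MvPolynomial (Fin n) F) : Prop :=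
  ∃ (L : List ℕ) (g : ℕ → MvPolynomial (Fin n) F),
    IsReducedWord n L w ∧ g 0 = f ∧ PibarChain F n L g ∧ g L.length = p

/-- The monomial `x_{α,i} = (∏_{j ∈ Des(α)} x_1⋯x_j) · x_1^{i_1}⋯x_n^{i_n}`. -/
def xAI (n : ℕ) (α : List ℕ) (i : ℕ → ℕ) : MvPolynomial (Fin n) F :=
  (∏ j ∈ desComp α, ∏ t ∈ Finset.range j, Xv F n t) *
    ∏ t ∈ Finset.range n, Xv F n t ^ i t

/-- The defining conditions for the index set `A_{n,k}`: `α` is a composition of `n`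
with `α_1 > n-k`, and `k - ℓ(α) ≥ i_1 ≥ ⋯ ≥ i_{n-k} ≥ 0 = i_{n-k+1} = ⋯ = i_n`
(the sequence `i` is 0-indexed: `i t` is the paper's `i_{t+1}`). -/
def Acond (n k : ℕ) (α : List ℕ) (i : ℕ → ℕ) : Prop :=
  IsComposition n α ∧ n - k < α.headI ∧ i 0 + α.length ≤ k ∧
    (∀ a b, a ≤ b → b < n - k → i b ≤ i a) ∧ ∀ t, n - k ≤ t → i t = 0

/-- The exponent vector of the generalized Garsia–Stanton monomial `gs_{w,i}`:
the variable `x_{w(t)}` has exponent `#{d ∈ Des(w) : d ≥ t} + i_t` (1-based `t`). -/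
def gsExp {n : ℕ} (w : Equiv.Perm (Fin n)) (i : ℕ → ℕ) : Fin n → ℕ := fun m =>
  ((permDes w).filter fun r => (w.symm m : ℕ) + 1 ≤ r).card + i (w.symm m : ℕ)

/-- The generalized Garsia–Stanton monomial `gs_{w,i}`. -/
def gsMono (n : ℕ) (w : Equiv.Perm (Fin n)) (i : ℕ → ℕ) : MvPolynomial (Fin n) F :=
  ∏ m : Fin n, MvPolynomial.X m ^ gsExp w i m

/-- The condition `k - des(w) > i_1 ≥ ⋯ ≥ i_{n-k} ≥ 0 = i_{n-k+1} = ⋯ = i_n` defining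
membership of `gs_{w,i}` in `GS_{n,k}`. -/
def GScond (n k : ℕ) (w : Equiv.Perm (Fin n)) (i : ℕ → ℕ) : Prop :=
  i 0 + (permDes w).card < k ∧ (∀ a b, a ≤ b → b < n - k → i b ≤ i a) ∧
    ∀ t, n - k ≤ t → i t = 0

/-- An ordered set partition of `[n]` with `k` blocks: a `k`-tuple of nonempty,
pairwise disjoint subsets of `Fin n` covering `Fin n`. -/
def OSP (n k : ℕ) : Type :=
  {B : Fin k → Finset (Fin n) // (∀ j, (B j).Nonempty) ∧
    (∀ j l, j ≠ l → ∀ x, x ∈ B j → x ∉ B l) ∧ ∀ x, ∃ j, x ∈ B j}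

/-- Relabelling the letters of an ordered set partition by a permutation. -/
def ospMap {n k : ℕ} (e : Equiv.Perm (Fin n)) (σ : OSP n k) : OSP n k :=
  ⟨fun j => (σ.1 j).image e, by
    obtain ⟨h1, h2, h3⟩ := σ.2
    refine ⟨fun j => (h1 j).image e, fun j l hjl x hx hx' => ?_, fun x => ?_⟩
    · rcases Finset.mem_image.1 hx with ⟨y, hy, hey⟩
      rcases Finset.mem_image.1 hx' with ⟨y', hy', hey'⟩
      have : y = y' := e.injective (hey.trans hey'.symm)
      exact h2 j l hjl y hy (this ▸ hy')
    · rcases h3 (e.symm x) with ⟨j, hj⟩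
      exact ⟨j, Finset.mem_image.2 ⟨e.symm x, hj, e.apply_symm_apply x⟩⟩⟩

/-- `b` lies in a block strictly to the left of the block of `a`. -/
def leftOf {n k : ℕ} (σ : OSP n k) (a b : Fin n) : Prop :=
  ∃ p q : Fin k, p < q ∧ b ∈ σ.1 p ∧ a ∈ σ.1 q

/-- `a` and `b` lie in the same block. -/
def sameBlock {n k : ℕ} (σ : OSP n k) (a b : Fin n) : Prop :=
  ∃ p : Fin k, a ∈ σ.1 p ∧ b ∈ σ.1 p

/-- The value of the 0-Hecke generator `π` (for the pair of letters `a = i`,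
`b = i+1`) on a basis element of `F[OP_{n,k}]`. -/
def heckeImg {n k : ℕ} (a b : Fin n) (σ : OSP n k) : OSP n k →₀ F :=
  if leftOf σ a b then 0
  else if sameBlock σ a b then Finsupp.single σ 1
  else Finsupp.single σ 1 + Finsupp.single (ospMap (Equiv.swap a b) σ) 1

/-- The 0-Hecke operator `π` on `F[OP_{n,k}]` for the pair of letters `a = i`, `b = i+1`. -/
def heckeOp {n k : ℕ} (a b : Fin n) (f : OSP n k →₀ F) : OSP n k →₀ F :=
  f.sum fun σ c => c • heckeImg F a b σ

/-- The value of the 0-Hecke generator `π̄ = π - 1` on a basis element of `F[OP_{n,k}]`. -/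
def pibarImg {n k : ℕ} (a b : Fin n) (σ : OSP n k) : OSP n k →₀ F :=
  if leftOf σ a b then -Finsupp.single σ 1
  else if sameBlock σ a b then 0
  else Finsupp.single (ospMap (Equiv.swap a b) σ) 1

/-- The 0-Hecke operator `π̄ = π - 1` on `F[OP_{n,k}]`. -/
def pibarOp {n k : ℕ} (a b : Fin n) (f : OSP n k →₀ F) : OSP n k →₀ F :=
  f.sum fun σ c => c • pibarImg F a b σ

/-- `IsShuffle l₁ l₂ l` : `l` is an interleaving of `l₁` and `l₂` preserving the
relative order of the entries of each. -/
inductive IsShuffle : List ℕ → List ℕ → List ℕ → Prop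
  | nil : IsShuffle [] [] []
  | left {a l₁ l₂ l} : IsShuffle l₁ l₂ l → IsShuffle (a :: l₁) l₂ (a :: l)
  | right {a l₁ l₂ l} : IsShuffle l₁ l₂ l → IsShuffle l₁ (a :: l₂) (a :: l)

/-- An `(n,k)`-staircase: a shuffle of `(k-1, k-2, …, 1, 0)` with `n-k` copies of `k-1`. -/
def IsStaircase (n k : ℕ) (s : Fin n → ℕ) : Prop :=
  ∃ L : List ℕ, IsShuffle ((List.range k).reverse) (List.replicate (n - k) (k - 1)) L ∧
    ∀ j : Fin n, s j = L.getD (j : ℕ) 0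

/-- `B` is an ordered set partition of `[n]` (`n = α.sum`) of shape `α`. -/
def IsOSPShape (α : List ℕ) (B : Fin α.length → Finset (Fin α.sum)) : Prop :=
  (∀ j, (B j).card = α.get j) ∧
    (∀ j l, j ≠ l → ∀ x, x ∈ B j → x ∉ B l) ∧ ∀ x, ∃ j, x ∈ B j

/-- The ordered set partition `({1,…,α_1} | {α_1+1,…,α_1+α_2} | ⋯)` of shape `α`,
as a tuple of blocks. -/
def sigma0 (α : List ℕ) : Fin α.length → Finset (Fin α.sum) := fun j =>
  Finset.univ.filter fun x =>
    (α.take (j : ℕ)).sum ≤ (x : ℕ) ∧ (x : ℕ) < (α.take ((j : ℕ) + 1)).sum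

section Shape

variable {n ℓ : ℕ}

/-- `b` lies in a block strictly to the left of the block of `a` (tuples of blocks). -/
def blkLeft (B : Fin ℓ → Finset (Fin n)) (a b : Fin n) : Prop :=
  ∃ p q : Fin ℓ, p < q ∧ b ∈ B p ∧ a ∈ B q

/-- `a` and `b` lie in the same block (tuples of blocks). -/
def blkSame (B : Fin ℓ → Finset (Fin n)) (a b : Fin n) : Prop :=
  ∃ p : Fin ℓ, a ∈ B p ∧ b ∈ B p

/-- The value of the 0-Hecke generator `π` (for letters `a = i`, `b = i+1`) on a basis
element of the free module on tuples of blocks. -/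
def shapeImg (a b : Fin n) (B : Fin ℓ → Finset (Fin n)) :
    (Fin ℓ → Finset (Fin n)) →₀ F :=
  if blkLeft B a b then 0
  else if blkSame B a b then Finsupp.single B 1
  else Finsupp.single B 1 + Finsupp.single (fun j => (B j).image (Equiv.swap a b)) 1

/-- The 0-Hecke operator `π` on the free module on tuples of blocks. -/
def shapeOp (a b : Fin n) (f : (Fin ℓ → Finset (Fin n)) →₀ F) :
    (Fin ℓ → Finset (Fin n)) →₀ F :=
  f.sum fun B c => c • shapeImg F a b B

end Shape

/-- A `k`-tuple of blocks is an ordered set partition of `[n]` with `k` blocks. -/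
def IsOSPFun {n k : ℕ} (B : Fin k → Finset (Fin n)) : Prop :=
  (∀ j, (B j).Nonempty) ∧ (∀ j l, j ≠ l → ∀ x, x ∈ B j → x ∉ B l) ∧ ∀ x, ∃ j, x ∈ B j

/-- The `t`-th block (0-based) of a tuple of blocks, extended by `∅` out of range. -/
def blockExt {n k : ℕ} (B : Fin k → Finset (Fin n)) (t : ℕ) : Finset (Fin n) :=
  if h : t < k then B ⟨t, h⟩ else ∅

/-- The word (values in `{1, …, n}`) obtained by listing the elements of each block in
increasing order, reading the blocks from left to right. -/
def ospWord {n k : ℕ} (B : Fin k → Finset (Fin n)) : List ℕ :=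
  (List.finRange k).flatMap fun j => ((B j).sort (· ≤ ·)).map fun x => (x : ℕ) + 1

/-- The major index of a word: the sum of the (1-based) positions `j` with
`L_j > L_{j+1}`. -/
def wordMaj (L : List ℕ) : ℕ :=
  ∑ j ∈ Finset.range (L.length - 1), if L.getD (j + 1) 0 < L.getD j 0 then j + 1 else 0

/-- The major index of an ordered set partition `σ = (B_1 | ⋯ | B_k)`:
`maj(σ) = maj(w) + ∑_{i : max(B_i) < min(B_{i+1})} (α_1 + ⋯ + α_i - i)`. -/
def ospMaj {n k : ℕ} (B : Fin k → Finset (Fin n)) : ℕ :=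
  wordMaj (ospWord B) +
    ∑ t ∈ Finset.range (k - 1),
      if ∀ a ∈ blockExt B t, ∀ b ∈ blockExt B (t + 1), a < b then
        (∑ j ∈ Finset.range (t + 1), (blockExt B j).card) - (t + 1)
      else 0

/-- The complete homogeneous symmetric function of degree `d` evaluated at field
elements `v_1, …, v_n`. -/
def hval {n : ℕ} (v : Fin n → F) (d : ℕ) : F :=
  ∑ s ∈ (Finset.univ : Finset (Sym (Fin n) d)), (s.1.map v).prod

/-- The elementary symmetric function of degree `d` evaluated at field elements
`v_1, …, v_n` (it vanishes for `d > n`). -/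
def esymval {n : ℕ} (v : Fin n → F) (d : ℕ) : F :=
  ∑ t ∈ Finset.powersetCard d Finset.univ, ∏ j ∈ t, v j

end OSPHecke

namespace OSPHecke

/-- The sum of the entries of `c` at the positions `m ≥ k`. -/
def tailSum {n : ℕ} (c : Fin n → ℕ) (k : ℕ) : ℕ :=
  ∑ m ∈ Finset.univ.filter (fun m : Fin n => k ≤ (m : ℕ)), c m

/-- For every position `k` and threshold `v`, the vector `b` has at most as many entries `≥ v`
at positions `≥ k` as `c` has. On rearrangements of a partition this is the Bruhat order. -/
def TailLe {n : ℕ} (b c : Fin n → ℕ) : Prop :=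
  ∀ k v, tailSum (fun m => if v ≤ b m then 1 else 0) k ≤
    tailSum (fun m => if v ≤ c m then 1 else 0) k

/-- Every coordinate sum of `a` is bounded by that of some vector below `c` for `TailLe`. -/
def HullLe {n : ℕ} (a c : Fin n → ℕ) : Prop :=
  ∀ S : Finset (Fin n), ∃ b, TailLe b c ∧ ∑ m ∈ S, a m ≤ ∑ m ∈ S, b m

theorem tailSum_eq_add {n : ℕ} (c : Fin n → ℕ) (i : Fin n) :
    tailSum c i = c i + tailSum c (i + 1) := by
  unfold tailSum
  rw [← Finset.sum_insert (by simp)]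
  congr 1
  ext m
  simp only [Finset.mem_filter, Finset.mem_univ, true_and, Finset.mem_insert, Fin.ext_iff]
  omega

theorem tailSum_comp_swap {n : ℕ} (c : Fin n → ℕ) (i j : Fin n) (hij : (j : ℕ) = i + 1)
    (k : ℕ) (hk : k ≠ j) : tailSum (fun m => c (Equiv.swap i j m)) k = tailSum c k := by
  unfold tailSum
  refine Finset.sum_equiv (Equiv.swap i j) (fun m => ?_) (fun _ _ => rfl)
  simp only [Finset.mem_filter, Finset.mem_univ, true_and, Equiv.swap_apply_def]
  split_ifs with h1 h2
  · subst h1; omega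
  · subst h2; omega
  · rfl

theorem tailSum_comp_swap_self {n : ℕ} (c : Fin n → ℕ) (i j : Fin n) (hij : (j : ℕ) = i + 1) :
    tailSum (fun m => c (Equiv.swap i j m)) j = c i + tailSum c (j + 1) := by
  rw [tailSum_eq_add, tailSum_comp_swap c i j hij _ (by omega), Equiv.swap_apply_right]

theorem TailLe.tailSum_le {n : ℕ} {b c : Fin n → ℕ} (h : TailLe b c) (k : ℕ) :
    tailSum b k ≤ tailSum c k := by
  obtain ⟨N, hN⟩ : ∃ N, ∀ m, b m ≤ N ∧ c m ≤ N :=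
    ⟨∑ m, (b m + c m), fun m => by
      have := Finset.single_le_sum (f := fun m => b m + c m) (fun _ _ => Nat.zero_le _)
        (Finset.mem_univ m)
      omega⟩
  have key : ∀ e : Fin n → ℕ, (∀ m, e m ≤ N) → tailSum e k =
      ∑ v ∈ Finset.Icc 1 N, tailSum (fun m => if v ≤ e m then 1 else 0) k := by
    intro e he
    unfold tailSum
    rw [Finset.sum_comm]
    refine Finset.sum_congr rfl fun m _ => ?_
    rw [← Finset.card_filter]
    have : (Finset.Icc 1 N).filter (fun v => v ≤ e m) = Finset.Icc 1 (e m) := by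
      ext v
      have := he m
      simp only [Finset.mem_filter, Finset.mem_Icc]
      omega
    rw [this, Nat.card_Icc, Nat.add_sub_cancel]
  rw [key b fun m => (hN m).1, key c fun m => (hN m).2]
  exact Finset.sum_le_sum fun v _ => h k v

theorem TailLe.swap_right {n : ℕ} {b c : Fin n → ℕ} (h : TailLe b c) {i j : Fin n}
    (hij : (j : ℕ) = i + 1) (hc : c j ≤ c i) :
    TailLe b (fun m => c (Equiv.swap i j m)) := by
  intro k v
  refine (h k v).trans ?_
  by_cases hk : k = j
  · subst hk
    rw [tailSum_comp_swap_self (fun m => if v ≤ c m then 1 else 0) i j hij, tailSum_eq_add]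
    gcongr
    split_ifs <;> omega
  · exact (tailSum_comp_swap (fun m => if v ≤ c m then 1 else 0) i j hij k hk).ge

theorem TailLe.swap {n : ℕ} {b c : Fin n → ℕ} (h : TailLe b c) {i j : Fin n}
    (hij : (j : ℕ) = i + 1) (hc : c j ≤ c i) :
    TailLe (fun m => b (Equiv.swap i j m)) (fun m => c (Equiv.swap i j m)) := by
  intro k v
  by_cases hk : k = j
  · subst hk
    rw [tailSum_comp_swap_self (fun m => if v ≤ c m then 1 else 0) i j hij,
      tailSum_comp_swap_self (fun m => if v ≤ b m then 1 else 0) i j hij]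
    have h1 := h i v
    have h2 := h (j + 1) v
    rw [tailSum_eq_add, tailSum_eq_add _ i, ← hij, tailSum_eq_add, tailSum_eq_add _ j] at h1
    split_ifs at h1 ⊢ <;> omega
  · rw [tailSum_comp_swap (fun m => if v ≤ c m then 1 else 0) i j hij k hk,
      tailSum_comp_swap (fun m => if v ≤ b m then 1 else 0) i j hij k hk]
    exact h k v

theorem HullLe.tailSum_le {n : ℕ} {a c : Fin n → ℕ} (h : HullLe a c) (k : ℕ) :
    tailSum a k ≤ tailSum c k := by
  obtain ⟨b, hb, hab⟩ := h (Finset.univ.filter fun m : Fin n => k ≤ (m : ℕ))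
  exact le_trans hab (hb.tailSum_le k)

theorem sum_comp_swap {n : ℕ} (c : Fin n → ℕ) (i j : Fin n) (S : Finset (Fin n)) :
    ∑ m ∈ S.image (Equiv.swap i j), c m = ∑ m ∈ S, c (Equiv.swap i j m) :=
  Finset.sum_image fun _ _ _ _ h => (Equiv.swap i j).injective h

theorem HullLe.swap {n : ℕ} {a c : Fin n → ℕ} (h : HullLe a c) {i j : Fin n}
    (hij : (j : ℕ) = i + 1) (hc : c j ≤ c i) :
    HullLe (fun m => a (Equiv.swap i j m)) (fun m => c (Equiv.swap i j m)) := by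
  intro S
  obtain ⟨b, hb, hab⟩ := h (S.image (Equiv.swap i j))
  refine ⟨_, hb.swap hij hc, ?_⟩
  rwa [sum_comp_swap, sum_comp_swap] at hab

theorem HullLe.swap_right {n : ℕ} {a c : Fin n → ℕ} (h : HullLe a c) {i j : Fin n}
    (hij : (j : ℕ) = i + 1) (hc : c j ≤ c i) :
    HullLe a (fun m => c (Equiv.swap i j m)) := fun S =>
  let ⟨b, hb, hab⟩ := h S
  ⟨b, hb.swap_right hij hc, hab⟩

/-- The vector `b` lies on the segment joining `a` to the vector obtained from `a` by exchanging
the entries at `i` and `j`. -/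
def Between {n : ℕ} (i j : Fin n) (a b : Fin n → ℕ) : Prop :=
  (∀ m, m ≠ i → m ≠ j → b m = a m) ∧ b i + b j = a i + a j ∧
    min (a i) (a j) ≤ b j ∧ b j ≤ max (a i) (a j)

theorem Between.sum_le {n : ℕ} {i j : Fin n} (hij : i ≠ j) {a b : Fin n → ℕ}
    (h : Between i j a b) (S : Finset (Fin n)) :
    ∑ m ∈ S, b m ≤ max (∑ m ∈ S, a m) (∑ m ∈ S, a (Equiv.swap i j m)) := by
  obtain ⟨h0, h1, h2, h3⟩ := h
  have hT : ∀ T : Finset (Fin n), i ∉ T → j ∉ T →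
      ∑ m ∈ T, b m = ∑ m ∈ T, a m ∧ ∑ m ∈ T, a (Equiv.swap i j m) = ∑ m ∈ T, a m := by
    refine fun T hi hj => ⟨Finset.sum_congr rfl fun m hm => ?_,
      Finset.sum_congr rfl fun m hm => ?_⟩
    · exact h0 m (ne_of_mem_of_not_mem hm hi) (ne_of_mem_of_not_mem hm hj)
    · rw [Equiv.swap_apply_of_ne_of_ne (ne_of_mem_of_not_mem hm hi) (ne_of_mem_of_not_mem hm hj)]
  by_cases hi : i ∈ S <;> by_cases hj : j ∈ S
  · obtain ⟨e1, e2⟩ := hT ((S.erase i).erase j) (by simp) (by simp)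
    have hj' : j ∈ S.erase i := Finset.mem_erase.2 ⟨hij.symm, hj⟩
    simp only [← Finset.add_sum_erase _ _ hi, ← Finset.add_sum_erase _ _ hj', e1, e2,
      Equiv.swap_apply_left, Equiv.swap_apply_right]
    omega
  · obtain ⟨e1, e2⟩ := hT (S.erase i) (by simp) (by simp [hj])
    simp only [← Finset.add_sum_erase _ _ hi, e1, e2, Equiv.swap_apply_left]
    omega
  · obtain ⟨e1, e2⟩ := hT (S.erase j) (by simp [hi]) (by simp)
    simp only [← Finset.add_sum_erase _ _ hj, e1, e2, Equiv.swap_apply_right]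
    omega
  · obtain ⟨e1, e2⟩ := hT S hi hj
    simp [e1]

theorem HullLe.of_between {n : ℕ} {a b c : Fin n → ℕ} (h : HullLe a c) {i j : Fin n}
    (hij : (j : ℕ) = i + 1) (hc : c j ≤ c i) (hb : Between i j a b) :
    HullLe b (fun m => c (Equiv.swap i j m)) := by
  intro S
  have hne : i ≠ j := fun e => by rw [e] at hij; omega
  rcases le_max_iff.1 (hb.sum_le hne S) with h' | h'
  · obtain ⟨e, he, hle⟩ := h.swap_right hij hc S
    exact ⟨e, he, h'.trans hle⟩
  · obtain ⟨e, he, hle⟩ := h.swap hij hc S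
    exact ⟨e, he, h'.trans hle⟩

theorem HullLe.eq_of_between_swap {n : ℕ} {a c : Fin n → ℕ} (h : HullLe a c) {i j : Fin n}
    (hij : (j : ℕ) = i + 1) (hc : c j < c i)
    (hb : Between i j a (fun m => c (Equiv.swap i j m))) : a = c := by
  obtain ⟨h0, h1, h2, h3⟩ := hb
  have h0' : ∀ m, m ≠ i → m ≠ j → a m = c m := fun m hi hj => by
    simpa only [Equiv.swap_apply_of_ne_of_ne hi hj] using (h0 m hi hj).symm
  simp only [Equiv.swap_apply_left, Equiv.swap_apply_right] at h1 h2 h3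
  have htail : tailSum a (j + 1) = tailSum c (j + 1) := by
    refine Finset.sum_congr rfl fun m hm => h0' m ?_ ?_ <;>
    · rintro rfl
      have := (Finset.mem_filter.1 hm).2
      omega
  have e1 := h.tailSum_le j
  rw [tailSum_eq_add, tailSum_eq_add c] at e1
  have e2 := (h.swap hij hc.le).tailSum_le j
  rw [tailSum_comp_swap_self a i j hij, tailSum_comp_swap_self c i j hij] at e2
  funext m
  by_cases hi : m = i
  · subst hi; omega
  by_cases hj : m = j
  · subst hj; omega
  exact h0' m hi hj

theorem HullLe.neglexLt {n : ℕ} {a c : Fin n → ℕ} (h : HullLe a c) (hne : a ≠ c) :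
    NeglexLt a c := by
  obtain ⟨m, hm⟩ := Function.ne_iff.1 hne
  obtain ⟨j, hj, hmax⟩ := (Finset.univ.filter fun m => a m ≠ c m).exists_max_image id
    ⟨m, by simpa using hm⟩
  have habove : ∀ l, j < l → a l = c l := fun l hl => by
    by_contra hcon
    exact absurd (hmax l (by simpa using hcon)) (not_le.2 hl)
  refine ⟨j, lt_of_le_of_ne ?_ (Finset.mem_filter.1 hj).2, habove⟩
  have htail : tailSum a (j + 1) = tailSum c (j + 1) :=
    Finset.sum_congr rfl fun l hl => habove l (Finset.mem_filter.1 hl).2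
  have := h.tailSum_le j
  rw [tailSum_eq_add, tailSum_eq_add c] at this
  omega

theorem swap_monomial_quotient (F : Type*) [Field F] {n : ℕ} (i j : Fin n) (b : Fin n →₀ ℕ)
    (m : ℕ) :
    (X i - X j) * ∑ k ∈ Finset.range m,
        monomial (b + Finsupp.single i k + Finsupp.single j (m - k)) (1 : F) =
      X j * (monomial (b + Finsupp.single i m) 1 - monomial (b + Finsupp.single j m) 1) := by
  have h1 : ∀ k l : ℕ, monomial (b + Finsupp.single i k + Finsupp.single j l) (1 : F) =
      monomial b 1 * X i ^ k * X j ^ l := fun k l => by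
    simp [X_pow_eq_monomial, monomial_mul]
  have h2 := h1 m 0
  have h3 := h1 0 m
  simp only [Finsupp.single_zero, add_zero, pow_zero, mul_one] at h2 h3
  rw [h2, h3, ← mul_sub, ← geom_sum₂_mul]
  have : ∑ k ∈ Finset.range m,
        monomial (b + Finsupp.single i k + Finsupp.single j (m - k)) (1 : F) =
      monomial b 1 * X j * ∑ k ∈ Finset.range m, X i ^ k * X j ^ (m - 1 - k) := by
    rw [Finset.mul_sum]
    refine Finset.sum_congr rfl fun k hk => ?_
    have hk := Finset.mem_range.1 hk
    rw [h1, show m - k = (m - 1 - k) + 1 by omega]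
    ring
  rw [this]
  ring

theorem exists_pibar_monomial_of_le (F : Type*) [Field F] {n : ℕ} {i j : Fin n} (hij : i ≠ j)
    (a : Fin n →₀ ℕ) (ha : a j ≤ a i) :
    ∃ D : MvPolynomial (Fin n) F,
      (X i - X j) * D =
        X j * (monomial a 1 - monomial (a.mapDomain (Equiv.swap i j)) 1) ∧
      (∀ b ∈ D.support, Between i j a b) ∧
      (a j < a i → coeff (a.mapDomain (Equiv.swap i j)) D = 1) := by
  set m := a i - a j with hm
  set b := a.update i (a j) with hbdef
  have hbi : b i = a j := by simp [hbdef]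
  have hb : ∀ l, l ≠ i → b l = a l := fun l hl => by simp [hbdef, Function.update_of_ne hl]
  have e1 : b + Finsupp.single i m = a := by
    ext l
    by_cases hl : l = i
    · subst hl; simp [hbi, hm, ha]
    · simp [hb l hl, Ne.symm hl]
  have e2 : b + Finsupp.single j m = a.mapDomain (Equiv.swap i j) := by
    ext l
    rw [Finsupp.mapDomain_equiv_apply, Equiv.symm_swap]
    by_cases hl : l = i
    · subst hl; simp [hbi, hij.symm]
    by_cases hl' : l = j
    · subst hl'; simp [hb l hl, hm, ha]
    · simp [hb l hl, Ne.symm hl', Equiv.swap_apply_of_ne_of_ne hl hl']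
  refine ⟨∑ k ∈ Finset.range m,
    monomial (b + Finsupp.single i k + Finsupp.single j (m - k)) (1 : F),
    ?_, fun c hc => ?_, fun hlt => ?_⟩
  · rw [← e2]
    nth_rewrite 1 [← e1]
    exact swap_monomial_quotient F i j b m
  · obtain ⟨k, hk, hc⟩ := Finset.mem_biUnion.1 (support_sum hc)
    have hk := Finset.mem_range.1 hk
    obtain rfl := Finset.mem_singleton.1 (support_monomial_subset hc)
    have hji := hb j hij.symm
    refine ⟨fun l hi hj => ?_, ?_, ?_, ?_⟩
    · simp [hb l hi, Ne.symm hi, Ne.symm hj]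
    all_goals
      simp only [Finsupp.add_apply, hbi, hji, Finsupp.single_apply, hij, hij.symm, if_true, if_false]
      omega
  · rw [coeff_sum, Finset.sum_eq_single 0]
    · rw [← e2]; simp
    · intro k hk hk0
      rw [coeff_monomial, if_neg]
      intro h
      have := DFunLike.congr_fun h i
      rw [← e2] at this
      simp [hij.symm] at this
      exact hk0 this
    · intro h
      simp only [Finset.mem_range] at h
      omega

theorem exists_pibar_monomial (F : Type*) [Field F] {n : ℕ} {i j : Fin n} (hij : i ≠ j)
    (a : Fin n →₀ ℕ) :
    ∃ D : MvPolynomial (Fin n) F,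
      (X i - X j) * D =
        X j * (monomial a 1 - monomial (a.mapDomain (Equiv.swap i j)) 1) ∧
      (∀ b ∈ D.support, Between i j a b) ∧
      (a j < a i → coeff (a.mapDomain (Equiv.swap i j)) D = 1) := by
  rcases le_total (a j) (a i) with h | h
  · exact exists_pibar_monomial_of_le F hij a h
  have hs : ∀ l, a.mapDomain (Equiv.swap i j) l = a (Equiv.swap i j l) := fun l => by
    rw [Finsupp.mapDomain_equiv_apply, Equiv.symm_swap]
  have hss : (a.mapDomain (Equiv.swap i j)).mapDomain (Equiv.swap i j) = a := by
    ext l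
    rw [Finsupp.mapDomain_equiv_apply, Equiv.symm_swap, hs, Equiv.swap_apply_self]
  obtain ⟨D, h1, h2, -⟩ := exists_pibar_monomial_of_le F hij (a.mapDomain (Equiv.swap i j))
    (by simpa [hs] using h)
  refine ⟨-D, ?_, fun b hb => ?_, fun h' => absurd h' (not_lt.2 h)⟩
  · rw [hss] at h1
    rw [mul_neg, h1]
    ring
  · rw [support_neg] at hb
    obtain ⟨h3, h4, h5, h6⟩ := h2 b hb
    simp only [hs, Equiv.swap_apply_left, Equiv.swap_apply_right] at h4 h5 h6
    refine ⟨fun l hi hj => ?_, by omega, by omega, by omega⟩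
    rw [h3 l hi hj, hs, Equiv.swap_apply_of_ne_of_ne hi hj]

theorem pibar_step (F : Type*) [Field F] {n : ℕ} {i j : Fin n} (hij : (j : ℕ) = i + 1)
    {f g : MvPolynomial (Fin n) F}
    (h : (X i - X j) * g = X j * (f - rename (Equiv.swap i j) f))
    {c : Fin n → ℕ} (hc : c j < c i)
    (hcoeff : coeff (Finsupp.equivFunOnFinite.symm c) f = 1)
    (hsupp : ∀ a ∈ f.support, HullLe a c) :
    coeff (Finsupp.equivFunOnFinite.symm fun m => c (Equiv.swap i j m)) g = 1 ∧
      ∀ a ∈ g.support, HullLe a (fun m => c (Equiv.swap i j m)) := by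
  have hne : i ≠ j := fun e => by rw [e] at hij; omega
  choose D hD1 hD2 hD3 using exists_pibar_monomial F hne
  have hg : g = ∑ a ∈ f.support, C (coeff a f) * D a := by
    have hX : (X i - X j : MvPolynomial (Fin n) F) ≠ 0 :=
      sub_ne_zero.2 fun e => hne (X_injective e)
    refine mul_left_cancel₀ hX ?_
    rw [h, Finset.mul_sum]
    nth_rewrite 1 2 [f.as_sum]
    rw [map_sum, ← Finset.sum_sub_distrib, Finset.mul_sum]
    refine Finset.sum_congr rfl fun a _ => ?_
    rw [mul_left_comm, hD1, rename_monomial]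
    have hC : ∀ e : Fin n →₀ ℕ, monomial e (coeff a f) = C (coeff a f) * monomial e 1 :=
      fun e => by rw [C_mul_monomial, mul_one]
    rw [hC a, hC]
    ring
  constructor
  · set c₀ := Finsupp.equivFunOnFinite.symm c with hc₀
    have hcs : (Finsupp.equivFunOnFinite.symm fun m => c (Equiv.swap i j m)) =
        c₀.mapDomain (Equiv.swap i j) := by
      ext l
      rw [Finsupp.mapDomain_equiv_apply, Equiv.symm_swap]
      rfl
    rw [hg, coeff_sum, Finset.sum_eq_single c₀]
    · rw [coeff_C_mul, hcoeff, one_mul, hcs]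
      exact hD3 c₀ hc
    · intro a ha hac
      rw [coeff_C_mul]
      by_contra hcon
      refine hac (DFunLike.coe_injective ?_)
      exact (hsupp a ha).eq_of_between_swap hij hc
        (hD2 a _ (mem_support_iff.2 (right_ne_zero_of_mul hcon)))
    · intro hn
      rw [mem_support_iff, hcoeff] at hn
      exact absurd one_ne_zero hn
  · intro b hb
    rw [hg] at hb
    obtain ⟨a, ha, hb⟩ := Finset.mem_biUnion.1 (support_sum hb)
    refine (hsupp a ha).of_between hij hc.le (hD2 a b ?_)
    rw [mem_support_iff, coeff_C_mul] at hb
    exact mem_support_iff.2 (right_ne_zero_of_mul hb)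

theorem swap_lt_swap_of_adjacent {n : ℕ} {i j p q : Fin n} (hij : (j : ℕ) = i + 1) (hpq : p < q)
    (h : ¬(p = i ∧ q = j)) : Equiv.swap i j p < Equiv.swap i j q := by
  simp only [Equiv.swap_apply_def, Fin.ext_iff, Fin.lt_def] at *
  split_ifs <;> omega

theorem adjSwap_eq {n t : ℕ} (h : t + 1 < n) :
    adjSwap n t = Equiv.swap ⟨t, Nat.lt_of_succ_lt h⟩ ⟨t + 1, h⟩ := dif_pos h

/-- The strong exchange condition: an inversion of a word can be undone by deleting a letter. -/
theorem exists_shorter_word {n : ℕ} (L : List ℕ) (hL : ∀ t ∈ L, t + 1 < n) (p q : Fin n)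
    (hpq : p < q) (hinv : (wordPerm n L).symm q < (wordPerm n L).symm p) :
    ∃ M : List ℕ, (∀ t ∈ M, t + 1 < n) ∧ wordPerm n M = Equiv.swap p q * wordPerm n L ∧
      M.length < L.length := by
  induction L generalizing p q with
  | nil => exact absurd hinv (not_lt.2 hpq.le)
  | cons r L ih =>
    have hr : r + 1 < n := hL r (by simp)
    have hL' : ∀ t ∈ L, t + 1 < n := fun t ht => hL t (by simp [ht])
    have hw : wordPerm n (r :: L) = adjSwap n r * wordPerm n L := by simp [wordPerm]
    rw [adjSwap_eq hr] at hw
    set i : Fin n := ⟨r, Nat.lt_of_succ_lt hr⟩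
    set j : Fin n := ⟨r + 1, hr⟩
    by_cases h : p = i ∧ q = j
    · obtain ⟨rfl, rfl⟩ := h
      exact ⟨L, hL', by rw [hw, Equiv.swap_mul_self_mul], by simp⟩
    · have hsymm : ∀ x, (wordPerm n (r :: L)).symm x =
          (wordPerm n L).symm (Equiv.swap i j x) := fun x => by
        rw [hw, Equiv.symm_apply_eq]
        simp
      rw [hsymm, hsymm] at hinv
      obtain ⟨M, hM, hMw, hlen⟩ :=
        ih hL' _ _ (swap_lt_swap_of_adjacent (i := i) (j := j) rfl hpq h) hinv
      refine ⟨r :: M, by simpa using ⟨hr, hM⟩, ?_, by simpa using hlen⟩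
      have : wordPerm n (r :: M) = adjSwap n r * wordPerm n M := by simp [wordPerm]
      rw [this, adjSwap_eq hr, hMw, hw, ← mul_assoc, ← mul_assoc, Equiv.mul_swap_eq_swap_mul,
        Equiv.swap_apply_self, Equiv.swap_apply_self]

theorem IsReducedWord.tail {n t : ℕ} {L : List ℕ} {w : Equiv.Perm (Fin n)}
    (h : IsReducedWord n (t :: L) w) : IsReducedWord n L (wordPerm n L) := by
  obtain ⟨h1, h2, h3⟩ := h
  refine ⟨fun r hr => h1 r (by simp [hr]), rfl, fun M hM hMw => ?_⟩
  have := h3 (t :: M) (by simpa using ⟨h1 t (by simp), hM⟩) (by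
    rw [← h2]
    simp only [wordPerm, List.map_cons, List.prod_cons] at hMw ⊢
    rw [hMw])
  simpa using this

theorem IsReducedWord.symm_lt_symm {n t : ℕ} {L : List ℕ} {w : Equiv.Perm (Fin n)}
    (h : IsReducedWord n (t :: L) w) (ht : t + 1 < n) :
    (wordPerm n L).symm ⟨t, Nat.lt_of_succ_lt ht⟩ < (wordPerm n L).symm ⟨t + 1, ht⟩ := by
  obtain ⟨h1, h2, h3⟩ := h
  by_contra hcon
  have hne : (wordPerm n L).symm ⟨t + 1, ht⟩ ≠
      (wordPerm n L).symm ⟨t, Nat.lt_of_succ_lt ht⟩ := fun e => by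
    simpa using (wordPerm n L).symm.injective e
  obtain ⟨M, hM, hMw, hlen⟩ := exists_shorter_word L (fun r hr => h1 r (by simp [hr]))
    ⟨t, Nat.lt_of_succ_lt ht⟩ ⟨t + 1, ht⟩ (by simp [Fin.lt_def])
    (lt_of_le_of_ne (not_lt.1 hcon) hne)
  have := h3 M hM (by
    rw [hMw, ← h2, ← adjSwap_eq ht]
    simp [wordPerm])
  simp only [List.length_cons] at this
  omega

theorem pibar_chain_leading (F : Type*) [Field F] {n : ℕ} {d : Fin n → ℕ} (hd : Antitone d)
    {g : ℕ → MvPolynomial (Fin n) F} (hg0 : g 0 = ∏ j, X j ^ d j)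
    (L : List ℕ) (w : Equiv.Perm (Fin n)) (hL : IsReducedWord n L w)
    (hw : ∀ p q, p < q → d p = d q → w p < w q) (hchain : PibarChain F n L g) :
    coeff (Finsupp.equivFunOnFinite.symm fun m => d (w.symm m)) (g L.length) = 1 ∧
      ∀ a ∈ (g L.length).support, HullLe a (fun m => d (w.symm m)) := by
  induction L generalizing w with
  | nil =>
    obtain rfl : 1 = w := hL.2.1
    have hg : g 0 = monomial (Finsupp.equivFunOnFinite.symm d) 1 := by
      rw [hg0, monomial_eq, Finsupp.prod_fintype _ _ (by simp)]
      simp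
    simp only [List.length_nil, hg, ← Equiv.Perm.inv_def, inv_one, Equiv.Perm.one_apply]
    refine ⟨by simp, fun a ha => ?_⟩
    obtain rfl := Finset.mem_singleton.1 (support_monomial_subset ha)
    exact fun S => ⟨d, fun _ _ => le_rfl, le_rfl⟩
  | cons t L ih =>
    have ht : t + 1 < n := hL.1 t (by simp)
    set i : Fin n := ⟨t, Nat.lt_of_succ_lt ht⟩ with hi
    set j : Fin n := ⟨t + 1, ht⟩ with hj
    have hij : (j : ℕ) = i + 1 := rfl
    have hlt : (wordPerm n L).symm i < (wordPerm n L).symm j := hL.symm_lt_symm ht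
    obtain rfl : Equiv.swap i j * wordPerm n L = w := by
      rw [← hL.2.1, ← adjSwap_eq ht]
      simp [wordPerm]
    set v := wordPerm n L with hv
    have hv' : ∀ p q, p < q → d p = d q → v p < v q := by
      intro p q hpq hdpq
      have h1 : Equiv.swap i j (v p) < Equiv.swap i j (v q) := hw p q hpq hdpq
      have h2 := swap_lt_swap_of_adjacent hij h1 fun ⟨h3, h4⟩ => by
        rw [Equiv.swap_apply_eq_iff, Equiv.swap_apply_left] at h3
        rw [Equiv.swap_apply_eq_iff, Equiv.swap_apply_right] at h4
        rw [← h3, ← h4, Equiv.symm_apply_apply, Equiv.symm_apply_apply] at hlt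
        exact absurd hlt (not_lt.2 hpq.le)
      simpa using h2
    have hrev : ∀ r, r < L.length → (t :: L).reverse.getD r 0 = L.reverse.getD r 0 :=
      fun r hr => by
        rw [List.reverse_cons, List.getD_append _ _ _ _ (by simpa using hr)]
    have hchain' : PibarChain F n L g := fun r hr => by
      have := hchain r (by simp only [List.length_cons]; omega)
      rwa [hrev r hr] at this
    obtain ⟨ih1, ih2⟩ := ih v hL.tail hv' hchain'
    have hlast := hchain L.length (by simp)
    have hget : (t :: L).reverse.getD L.length 0 = t := by
      rw [List.reverse_cons, List.getD_append_right _ _ _ _ (by simp)]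
      simp
    rw [hget, PibarRel, adjSwap_eq ht, Xv, Xv, dif_pos ht, dif_pos (Nat.lt_of_succ_lt ht)] at hlast
    have hc : d (v.symm j) < d (v.symm i) := by
      refine lt_of_le_of_ne (hd hlt.le) fun e => ?_
      have := hw _ _ hlt e.symm
      simp [Fin.lt_def, hi, hj] at this
    exact pibar_step F hij hlast hc ih1 ih2

theorem lt_of_descents_subset {n : ℕ} {d : Fin n → ℕ} (hd : Antitone d)
    {w : Equiv.Perm (Fin n)}
    (hdes : ∀ (t : ℕ) (ht : t + 1 < n),
      w ⟨t + 1, ht⟩ < w ⟨t, Nat.lt_of_succ_lt ht⟩ →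
        d ⟨t + 1, ht⟩ < d ⟨t, Nat.lt_of_succ_lt ht⟩)
    (p q : Fin n) (hpq : p < q) (h : d p = d q) : w p < w q := by
  obtain ⟨q, hq⟩ := q
  have hpq' : (p : ℕ) + 1 ≤ q := hpq
  clear hpq
  have step : ∀ (t : ℕ) (ht : t + 1 < n), d ⟨t, Nat.lt_of_succ_lt ht⟩ = d ⟨t + 1, ht⟩ →
      w ⟨t, Nat.lt_of_succ_lt ht⟩ < w ⟨t + 1, ht⟩ := fun t ht e => by
    refine lt_of_le_of_ne (not_lt.1 fun hlt => (hdes t ht hlt).ne e.symm) fun e' => ?_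
    simpa using w.injective e'
  induction q, hpq' using Nat.le_induction with
  | base => exact step p hq h
  | succ q hpq ih =>
    have hq' : q < n := Nat.lt_of_succ_lt hq
    have h1 : d ⟨q, hq'⟩ ≤ d p := hd (by rw [Fin.le_def]; simp only; omega)
    have h2 : d ⟨q + 1, hq⟩ ≤ d ⟨q, hq'⟩ := hd (by rw [Fin.le_def]; simp only; omega)
    exact (ih hq' (by omega)).trans (step q hq (by omega))

/-- Let `d_1 ≥ ⋯ ≥ d_n ≥ 0` and let `w ∈ S_n` with
`Des(w) ⊆ Des(d)`. For any reduced word of `w`, the polynomial `π̄_w(x^d)` (computed by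
iterating the operators `π̄_i` along the reduced word) is nonzero, and its neglex-leading
term is the monomial `w(x^d) = x_{w(1)}^{d_1}⋯x_{w(n)}^{d_n}`, with coefficient `1`. -/
theorem pibar_leading_term (F : Type*) [Field F] (n : ℕ) (d : Fin n → ℕ)
    (hd : Antitone d) (w : Equiv.Perm (Fin n))
    (hdes : ∀ (t : ℕ) (ht : t + 1 < n),
      w ⟨t + 1, ht⟩ < w ⟨t, Nat.lt_of_succ_lt ht⟩ →
        d ⟨t + 1, ht⟩ < d ⟨t, Nat.lt_of_succ_lt ht⟩)
    (L : List ℕ) (hL : IsReducedWord n L w)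
    (g : ℕ → MvPolynomial (Fin n) F)
    (hg0 : g 0 = ∏ j, MvPolynomial.X j ^ d j)
    (hchain : PibarChain F n L g) :
    MvPolynomial.coeff
        (Finsupp.equivFunOnFinite.symm fun m => d (w.symm m)) (g L.length) = 1 ∧
    ∀ a ∈ (g L.length).support,
      a ≠ Finsupp.equivFunOnFinite.symm (fun m => d (w.symm m)) →
        NeglexLt ⇑a (fun m => d (w.symm m)) := by
  obtain ⟨h1, h2⟩ :=
    pibar_chain_leading F hd hg0 L w hL (lt_of_descents_subset hd hdes) hchain
  refine ⟨h1, fun a ha hne => (h2 a ha).neglexLt fun e => hne ?_⟩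
  exact DFunLike.coe_injective e

end OSPHecke
end
end

section
/- Let F be a field, let d_1 ≥ ⋯ ≥ d_n ≥ 0 be integers with x^d = x_1^{d_1}⋯x_n^{d_n}, and let α, β be compositions of n with Des(α) ⊆ Des(β) and Des(β) = Des(d) := {j : d_j > d_{j+1}}. Let w_0(α) be the unique minimal-length permutation in S_n with descent set Des(α), and for each w ∈ S_n define π̄_w(x^d) by applying π̄_{i_1}∘⋯∘π̄_{i_ℓ} for a reduced word w = s_{i_1}⋯s_{i_ℓ} (the result is independent of the reduced word). Then the set {π̄_w(x^d) : w ∈ S_n, Des(α) ⊆ Des(w) ⊆ Des(β)} is linearly independent over F, and its span equals the smallest F-subspace of F[x_1,…,x_n] that contains π̄_{w_0(α)}(x^d) and is closed under all the operators π̄_1,…,π̄_{n−1}. -/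
open scoped Classical
open MvPolynomial

noncomputable section

namespace OSPHecke

section Perm

variable {n : ℕ}

theorem adjSwap_val {t : ℕ} (h : t + 1 < n) (k : Fin n) :
    (adjSwap n t k : ℕ) = if (k : ℕ) = t then t + 1 else if (k : ℕ) = t + 1 then t else k := by
  simp only [adjSwap, h, dite_true, Equiv.swap_apply_def, Fin.ext_iff]
  split_ifs <;> simp_all

theorem adjSwap_mul_self (n t : ℕ) : adjSwap n t * adjSwap n t = 1 := by
  unfold adjSwap
  split_ifs <;> simp

theorem adjSwap_mul_cancel (t : ℕ) (w : Equiv.Perm (Fin n)) :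
    adjSwap n t * (adjSwap n t * w) = w := by
  rw [← mul_assoc, adjSwap_mul_self, one_mul]

theorem adjSwap_inv (n t : ℕ) : (adjSwap n t)⁻¹ = adjSwap n t :=
  inv_eq_of_mul_eq_one_left (adjSwap_mul_self n t)

theorem adjSwap_mul_symm_apply (t : ℕ) (w : Equiv.Perm (Fin n)) (k : Fin n) :
    (adjSwap n t * w).symm k = w.symm (adjSwap n t k) := by
  rw [Equiv.symm_apply_eq, Equiv.Perm.mul_apply, Equiv.apply_symm_apply,
    ← Equiv.Perm.mul_apply, adjSwap_mul_self, Equiv.Perm.one_apply]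

theorem adjSwap_apply_left {t : ℕ} (h : t + 1 < n) :
    adjSwap n t ⟨t, Nat.lt_of_succ_lt h⟩ = ⟨t + 1, h⟩ := by
  ext; simp [adjSwap_val h]

theorem adjSwap_apply_right {t : ℕ} (h : t + 1 < n) :
    adjSwap n t ⟨t + 1, h⟩ = ⟨t, Nat.lt_of_succ_lt h⟩ := by
  ext; simp [adjSwap_val h]

theorem adjSwap_apply_of_ne {t : ℕ} {k : Fin n} (h₁ : (k : ℕ) ≠ t) (h₂ : (k : ℕ) ≠ t + 1) :
    adjSwap n t k = k := by
  by_cases h : t + 1 < n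
  · ext; simp [adjSwap_val h, h₁, h₂]
  · simp [adjSwap, h]

theorem adjSwap_comm {i j : ℕ} (hij : i + 1 < j) :
    adjSwap n i * adjSwap n j = adjSwap n j * adjSwap n i := by
  by_cases hj : j + 1 < n
  · ext k
    simp only [Equiv.Perm.mul_apply, adjSwap_val hj, adjSwap_val (show i + 1 < n by omega)]
    grind
  · simp [adjSwap, hj]

theorem adjSwap_braid {i : ℕ} (hi : i + 2 < n) :
    adjSwap n i * adjSwap n (i + 1) * adjSwap n i =
      adjSwap n (i + 1) * adjSwap n i * adjSwap n (i + 1) := by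
  ext k
  simp only [Equiv.Perm.mul_apply, adjSwap_val (show i + 1 + 1 < n by omega),
    adjSwap_val (show i + 1 < n by omega)]
  grind

/-- `t` precedes `t + 1` (0-based values) in the one-line notation of `w`, that is,
`t` is not a left descent of `w`. -/
def IsLeftAscent (w : Equiv.Perm (Fin n)) (t : ℕ) : Prop :=
  ∃ h : t + 1 < n, w.symm ⟨t, Nat.lt_of_succ_lt h⟩ < w.symm ⟨t + 1, h⟩

/-- `t + 1` precedes `t` (0-based values) in the one-line notation of `w`. -/
def IsLeftDescent (w : Equiv.Perm (Fin n)) (t : ℕ) : Prop :=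
  ∃ h : t + 1 < n, w.symm ⟨t + 1, h⟩ < w.symm ⟨t, Nat.lt_of_succ_lt h⟩

theorem isLeftAscent_or_isLeftDescent (w : Equiv.Perm (Fin n)) {t : ℕ} (h : t + 1 < n) :
    IsLeftAscent w t ∨ IsLeftDescent w t := by
  rcases lt_trichotomy (w.symm ⟨t, Nat.lt_of_succ_lt h⟩) (w.symm ⟨t + 1, h⟩) with h' | h' | h'
  · exact Or.inl ⟨h, h'⟩
  · simp at h'
  · exact Or.inr ⟨h, h'⟩

theorem IsLeftDescent.isLeftAscent {w : Equiv.Perm (Fin n)} {t : ℕ} (h : IsLeftDescent w t) :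
    IsLeftAscent (adjSwap n t * w) t := by
  obtain ⟨ht, h⟩ := h
  refine ⟨ht, ?_⟩
  rwa [adjSwap_mul_symm_apply, adjSwap_mul_symm_apply, adjSwap_apply_left ht,
    adjSwap_apply_right ht]

theorem adjSwap_lt_iff {t : ℕ} (h : t + 1 < n) {x y : Fin n} :
    adjSwap n t y < adjSwap n t x ↔
      (y < x ∧ ¬((y : ℕ) = t ∧ (x : ℕ) = t + 1)) ∨ ((x : ℕ) = t ∧ (y : ℕ) = t + 1) := by
  simp only [Fin.lt_def, adjSwap_val h]
  grind

theorem IsLeftAscent.invCount_mul {w : Equiv.Perm (Fin n)} {t : ℕ} (h : IsLeftAscent w t) :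
    invCount (adjSwap n t * w) = invCount w + 1 := by
  obtain ⟨ht, h⟩ := h
  unfold invCount
  rw [← Finset.card_insert_of_notMem
    (a := (w.symm ⟨t, Nat.lt_of_succ_lt ht⟩, w.symm ⟨t + 1, ht⟩))]
  · congr 1
    ext ⟨p, q⟩
    simp only [Finset.mem_filter, Finset.mem_univ, true_and, Finset.mem_insert, Prod.mk.injEq,
      Equiv.Perm.mul_apply, adjSwap_lt_iff ht, Equiv.eq_symm_apply]
    have h₁ : ((w p : ℕ) = t) ↔ w p = ⟨t, Nat.lt_of_succ_lt ht⟩ := by simp [Fin.ext_iff]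
    have h₂ : ((w p : ℕ) = t + 1) ↔ w p = ⟨t + 1, ht⟩ := by simp [Fin.ext_iff]
    have h₃ : ((w q : ℕ) = t) ↔ w q = ⟨t, Nat.lt_of_succ_lt ht⟩ := by simp [Fin.ext_iff]
    have h₄ : ((w q : ℕ) = t + 1) ↔ w q = ⟨t + 1, ht⟩ := by simp [Fin.ext_iff]
    rw [h₁, h₂, h₃, h₄]
    simp only [← Equiv.eq_symm_apply]
    constructor
    · tauto
    · rintro (⟨rfl, rfl⟩ | ⟨hpq, hlt⟩)
      · exact ⟨h, Or.inr ⟨rfl, rfl⟩⟩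
      · refine ⟨hpq, Or.inl ⟨hlt, ?_⟩⟩
        rintro ⟨rfl, rfl⟩
        exact absurd h hpq.asymm
  · simp

theorem IsLeftDescent.invCount_mul {w : Equiv.Perm (Fin n)} {t : ℕ} (h : IsLeftDescent w t) :
    invCount (adjSwap n t * w) + 1 = invCount w := by
  rw [← h.isLeftAscent.invCount_mul, adjSwap_mul_cancel]

theorem invCount_one : invCount (1 : Equiv.Perm (Fin n)) = 0 := by
  simp only [invCount, Finset.card_eq_zero, Finset.filter_eq_empty_iff]
  rintro ⟨p, q⟩ - ⟨h₁, h₂⟩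
  exact absurd h₁ h₂.asymm

theorem perm_eq_of_lt_iff {u v : Equiv.Perm (Fin n)}
    (h : ∀ p q, p < q → (u q < u p ↔ v q < v p)) : u = v := by
  have key : ∀ p q, u p < u q ↔ v p < v q := by
    intro p q
    rcases lt_trichotomy p q with hpq | rfl | hpq
    · have := h p q hpq
      have hu : u p ≠ u q := u.injective.ne hpq.ne
      have hv : v p ≠ v q := v.injective.ne hpq.ne
      rw [← not_iff_not, not_lt, not_lt, hu.symm.le_iff_lt, hv.symm.le_iff_lt, this]
    · simp
    · exact h q p hpq
  let e : Fin n ≃o Fin n :=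
    StrictMono.orderIsoOfSurjective (fun k => v (u.symm k))
      (fun a b hab => by rw [← key]; simpa using hab)
      (v.surjective.comp u.symm.surjective)
  have he : e = OrderIso.refl _ := Subsingleton.elim _ _
  ext k
  have h₁ : e (u k) = u k := by rw [he]; rfl
  have h₂ : e (u k) = v k := congrArg v (u.symm_apply_apply k)
  rw [← h₁, h₂]

theorem eq_one_of_forall_isLeftAscent {w : Equiv.Perm (Fin n)}
    (h : ∀ t, ¬ IsLeftDescent w t) : w = 1 := by
  have hm : ∀ p q : Fin n, p < q → w.symm p < w.symm q := by
    rintro ⟨p, hp⟩ ⟨q, hq⟩ hpq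
    simp only [Fin.mk_lt_mk] at hpq
    induction q, hpq using Nat.le_induction with
    | base =>
      rcases isLeftAscent_or_isLeftDescent w hq with ⟨_, h'⟩ | h'
      · exact h'
      · exact absurd h' (h _)
    | succ q _ ih =>
      rcases isLeftAscent_or_isLeftDescent w hq with ⟨_, h'⟩ | h'
      · exact (ih _).trans h'
      · exact absurd h' (h _)
  have : w.symm = 1 := perm_eq_of_lt_iff fun p q hpq => by
    simp [hpq.asymm, (hm p q hpq).asymm]
  ext k
  have := congrArg (fun e : Equiv.Perm (Fin n) => w (e k)) this
  simp at this
  rw [← this]; simp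

theorem wordPerm_cons (t : ℕ) (L : List ℕ) :
    wordPerm n (t :: L) = adjSwap n t * wordPerm n L := by
  simp [wordPerm]

theorem invCount_wordPerm_le {L : List ℕ} (hL : ∀ t ∈ L, t + 1 < n) :
    invCount (wordPerm n L) ≤ L.length := by
  induction L with
  | nil => simp [wordPerm, invCount_one]
  | cons t L ih =>
    have := ih fun s hs => hL s (by simp [hs])
    rw [wordPerm_cons, List.length_cons]
    rcases isLeftAscent_or_isLeftDescent (wordPerm n L) (hL t (by simp)) with h | h
    · have := h.invCount_mul
      omega
    · have := h.invCount_mul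
      omega

theorem exists_word (w : Equiv.Perm (Fin n)) :
    ∃ L : List ℕ, (∀ t ∈ L, t + 1 < n) ∧ wordPerm n L = w ∧ L.length = invCount w := by
  induction hk : invCount w generalizing w with
  | zero =>
    refine ⟨[], by simp, ?_, rfl⟩
    rw [eq_one_of_forall_isLeftAscent (w := w) fun t ht => ?_]
    · rfl
    · have := ht.invCount_mul
      omega
  | succ k ih =>
    have : ∃ t, IsLeftDescent w t := by
      by_contra! hc
      rw [eq_one_of_forall_isLeftAscent hc, invCount_one] at hk
      omega
    obtain ⟨t, ht⟩ := this
    obtain ⟨L, hL, hw, hl⟩ := ih (adjSwap n t * w) (by have := ht.invCount_mul; omega)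
    refine ⟨t :: L, ?_, ?_, by simp [hl]⟩
    · intro s hs
      rcases List.mem_cons.1 hs with rfl | hs
      · exact ht.1
      · exact hL s hs
    · rw [wordPerm_cons, hw, adjSwap_mul_cancel]

theorem isReducedWord_iff {L : List ℕ} {w : Equiv.Perm (Fin n)} :
    IsReducedWord n L w ↔
      (∀ t ∈ L, t + 1 < n) ∧ wordPerm n L = w ∧ L.length = invCount w := by
  constructor
  · rintro ⟨h₁, h₂, h₃⟩
    obtain ⟨L', hL', hw, hl⟩ := exists_word w
    exact ⟨h₁, h₂, le_antisymm (hl ▸ h₃ L' hL' hw) (h₂ ▸ invCount_wordPerm_le h₁)⟩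
  · rintro ⟨h₁, h₂, h₃⟩
    refine ⟨h₁, h₂, fun L' hL' hw => ?_⟩
    rw [h₃, ← hw]
    exact invCount_wordPerm_le hL'

theorem exists_isReducedWord (w : Equiv.Perm (Fin n)) : ∃ L, IsReducedWord n L w := by
  simpa only [isReducedWord_iff] using exists_word w

theorem IsReducedWord.cons {L : List ℕ} {w : Equiv.Perm (Fin n)} {t : ℕ}
    (hL : IsReducedWord n L w) (ht : IsLeftAscent w t) :
    IsReducedWord n (t :: L) (adjSwap n t * w) := by
  rw [isReducedWord_iff] at hL ⊢
  obtain ⟨h₁, h₂, h₃⟩ := hL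
  refine ⟨?_, by rw [wordPerm_cons, h₂], by rw [ht.invCount_mul, List.length_cons, h₃]⟩
  intro s hs
  rcases List.mem_cons.1 hs with rfl | hs
  · exact ht.1
  · exact h₁ s hs

theorem IsReducedWord.of_cons {L : List ℕ} {w : Equiv.Perm (Fin n)} {t : ℕ}
    (hL : IsReducedWord n (t :: L) w) :
    IsLeftDescent w t ∧ IsReducedWord n L (adjSwap n t * w) := by
  rw [isReducedWord_iff] at hL
  obtain ⟨h₁, h₂, h₃⟩ := hL
  rw [wordPerm_cons] at h₂
  have h₁' : ∀ s ∈ L, s + 1 < n := fun s hs => h₁ s (by simp [hs])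
  have hw : wordPerm n L = adjSwap n t * w := by rw [← h₂, adjSwap_mul_cancel]
  have hle := invCount_wordPerm_le h₁'
  rw [List.length_cons] at h₃
  rw [hw] at hle
  have hd : IsLeftDescent w t := by
    rcases isLeftAscent_or_isLeftDescent w (h₁ t (by simp)) with h | h
    · have := h.invCount_mul
      omega
    · exact h
  refine ⟨hd, isReducedWord_iff.2 ⟨h₁', hw, ?_⟩⟩
  have := hd.invCount_mul
  omega

theorem IsLeftDescent.exists_isReducedWord {w : Equiv.Perm (Fin n)} {t : ℕ}
    (h : IsLeftDescent w t) :
    ∃ L, IsReducedWord n L (adjSwap n t * w) ∧ IsReducedWord n (t :: L) w := by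
  obtain ⟨L, hL⟩ := OSPHecke.exists_isReducedWord (adjSwap n t * w)
  refine ⟨L, hL, ?_⟩
  simpa only [adjSwap_mul_cancel] using hL.cons h.isLeftAscent

/-- **Matsumoto's theorem** for the symmetric group: a family of elements of a monoid
satisfying the braid relations has the same product along any two reduced words of the
same permutation. -/
theorem prod_map_eq_of_isReducedWord {M : Type*} [Monoid M] (f : ℕ → M)
    (hcomm : ∀ i j, i + 1 < j → j + 1 < n → f i * f j = f j * f i)
    (hbraid : ∀ i, i + 2 < n → f i * f (i + 1) * f i = f (i + 1) * f i * f (i + 1))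
    {L L' : List ℕ} {w : Equiv.Perm (Fin n)}
    (hL : IsReducedWord n L w) (hL' : IsReducedWord n L' w) :
    (L.map f).prod = (L'.map f).prod := by
  induction hk : L.length using Nat.strong_induction_on generalizing L L' w with
  | _ k ih =>
  have hlen : L.length = L'.length := by
    rw [(isReducedWord_iff.1 hL).2.2, (isReducedWord_iff.1 hL').2.2]
  match L, L', hL, hL' with
  | [], [], _, _ => rfl
  | [], _ :: _, _, _ => simp at hlen
  | _ :: _, [], _, _ => simp at hlen
  | i :: A, j :: B, hL, hL' =>
    obtain ⟨hi, hA⟩ := hL.of_cons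
    obtain ⟨hj, hB⟩ := hL'.of_cons
    simp only [List.length_cons] at hk hlen
    simp only [List.map_cons, List.prod_cons]
    have far : ∀ {i j : ℕ} {A B : List ℕ}, A.length < k → B.length < k → i + 1 < j →
        IsReducedWord n A (adjSwap n i * w) → IsReducedWord n B (adjSwap n j * w) →
        IsLeftDescent w i → IsLeftDescent w j →
        f i * (A.map f).prod = f j * (B.map f).prod := by
      intro i j A B hAk hBk hij hA hB hi hj
      have hj' : IsLeftDescent (adjSwap n i * w) j := by
        obtain ⟨hjn, hj⟩ := hj
        refine ⟨hjn, ?_⟩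
        rwa [adjSwap_mul_symm_apply, adjSwap_mul_symm_apply,
          adjSwap_apply_of_ne (by simp; omega) (by simp; omega),
          adjSwap_apply_of_ne (by simp; omega) (by simp; omega)]
      have hi' : IsLeftDescent (adjSwap n j * w) i := by
        obtain ⟨hin, hi⟩ := hi
        refine ⟨hin, ?_⟩
        rwa [adjSwap_mul_symm_apply, adjSwap_mul_symm_apply,
          adjSwap_apply_of_ne (by simp; omega) (by simp; omega),
          adjSwap_apply_of_ne (by simp; omega) (by simp; omega)]
      obtain ⟨K, hK, hjK⟩ := hj'.exists_isReducedWord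
      have hiK : IsReducedWord n (i :: K) (adjSwap n j * w) := by
        rw [← mul_assoc, ← adjSwap_comm hij, mul_assoc] at hK
        simpa only [adjSwap_mul_cancel] using hK.cons hi'.isLeftAscent
      rw [ih _ hAk hA hjK rfl, ih _ hBk hB hiK rfl]
      simp only [List.map_cons, List.prod_cons, ← mul_assoc, hcomm i j hij hj.1]
    have near : ∀ {i : ℕ} {A B : List ℕ}, A.length < k → B.length < k →
        IsReducedWord n A (adjSwap n i * w) → IsReducedWord n B (adjSwap n (i + 1) * w) →
        IsLeftDescent w i → IsLeftDescent w (i + 1) →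
        f i * (A.map f).prod = f (i + 1) * (B.map f).prod := by
      intro i A B hAk hBk hA hB ⟨hin, hi⟩ ⟨hjn, hj⟩
      have e₁ : adjSwap n i ⟨i + 1 + 1, hjn⟩ = ⟨i + 1 + 1, hjn⟩ :=
        adjSwap_apply_of_ne (by simp; omega) (by simp)
      have e₂ : adjSwap n (i + 1) ⟨i, Nat.lt_of_succ_lt hin⟩ = ⟨i, Nat.lt_of_succ_lt hin⟩ :=
        adjSwap_apply_of_ne (by simp) (by simp; omega)
      have e₃ := adjSwap_apply_left hin
      have e₄ := adjSwap_apply_right hin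
      have e₅ := adjSwap_apply_left hjn
      have e₆ := adjSwap_apply_right hjn
      have d₁ : IsLeftDescent (adjSwap n i * w) (i + 1) := by
        refine ⟨hjn, ?_⟩
        rw [adjSwap_mul_symm_apply, adjSwap_mul_symm_apply, e₁, e₄]
        exact hj.trans hi
      have d₂ : IsLeftDescent (adjSwap n (i + 1) * (adjSwap n i * w)) i := by
        refine ⟨hin, ?_⟩
        simp only [adjSwap_mul_symm_apply]
        rwa [e₅, e₁, e₂, e₃]
      have d₃ : IsLeftDescent (adjSwap n (i + 1) * w) i := by
        refine ⟨hin, ?_⟩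
        rw [adjSwap_mul_symm_apply, adjSwap_mul_symm_apply, e₂, e₅]
        exact hj.trans hi
      have d₄ : IsLeftDescent (adjSwap n i * (adjSwap n (i + 1) * w)) (i + 1) := by
        refine ⟨hjn, ?_⟩
        simp only [adjSwap_mul_symm_apply]
        rwa [e₁, e₆, e₄, e₂]
      obtain ⟨K, hK, hK₁⟩ := d₂.exists_isReducedWord
      have hjK : IsReducedWord n ((i + 1) :: i :: K) (adjSwap n i * w) := by
        simpa only [adjSwap_mul_cancel] using hK₁.cons d₁.isLeftAscent
      have hK' : IsReducedWord n K
          (adjSwap n (i + 1) * (adjSwap n i * (adjSwap n (i + 1) * w))) := by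
        have := adjSwap_braid (n := n) (i := i) (by omega)
        simpa only [← mul_assoc, this] using hK
      have hK₂ : IsReducedWord n ((i + 1) :: K) (adjSwap n i * (adjSwap n (i + 1) * w)) := by
        simpa only [adjSwap_mul_cancel] using hK'.cons d₄.isLeftAscent
      have hiK : IsReducedWord n (i :: (i + 1) :: K) (adjSwap n (i + 1) * w) := by
        simpa only [adjSwap_mul_cancel] using hK₂.cons d₃.isLeftAscent
      rw [ih _ hAk hA hjK rfl, ih _ hBk hB hiK rfl]
      simp only [List.map_cons, List.prod_cons, ← mul_assoc, hbraid i (by omega)]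
    have hAk : A.length < k := by omega
    have hBk : B.length < k := by omega
    rcases lt_trichotomy i j with hij | rfl | hij
    · rcases (show i + 1 < j ∨ j = i + 1 by omega) with h | rfl
      · exact far hAk hBk h hA hB hi hj
      · exact near hAk hBk hA hB hi hj
    · rw [ih _ hAk hA hB rfl]
    · rcases (show j + 1 < i ∨ i = j + 1 by omega) with h | rfl
      · exact (far hBk hAk h hB hA hj hi).symm
      · exact (near hBk hAk hB hA hj hi).symm

end Perm

section Descent

variable {n : ℕ}

theorem succ_mem_permDes {w : Equiv.Perm (Fin n)} {j : ℕ} :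
    j + 1 ∈ permDes w ↔ ∃ h : j + 1 < n, w ⟨j + 1, h⟩ < w ⟨j, Nat.lt_of_succ_lt h⟩ := by
  rw [permDes, Finset.mem_filter, Finset.mem_Ico]
  simp only [permVal, Nat.add_sub_cancel]
  constructor
  · rintro ⟨⟨-, h⟩, hlt⟩
    exact ⟨h, by simpa [h, Nat.lt_of_succ_lt h] using hlt⟩
  · rintro ⟨h, hlt⟩
    exact ⟨⟨by omega, h⟩, by simpa [h, Nat.lt_of_succ_lt h] using hlt⟩

theorem exists_eq_succ_of_mem_permDes {w : Equiv.Perm (Fin n)} {j : ℕ} (h : j ∈ permDes w) :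
    ∃ i, j = i + 1 := by
  refine ⟨j - 1, ?_⟩
  have := (Finset.mem_Ico.1 (Finset.mem_filter.1 h).1).1
  omega

theorem IsLeftAscent.permDes_subset {u : Equiv.Perm (Fin n)} {t : ℕ} (h : IsLeftAscent u t) :
    permDes u ⊆ permDes (adjSwap n t * u) := by
  intro j hj
  obtain ⟨j, rfl⟩ := exists_eq_succ_of_mem_permDes hj
  obtain ⟨ht, h⟩ := h
  rw [succ_mem_permDes] at hj ⊢
  obtain ⟨hjn, hj⟩ := hj
  refine ⟨hjn, ?_⟩
  rw [Equiv.Perm.mul_apply, Equiv.Perm.mul_apply, adjSwap_lt_iff ht]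
  refine Or.inl ⟨hj, ?_⟩
  rintro ⟨h₁, h₂⟩
  have e₁ : u.symm ⟨t, Nat.lt_of_succ_lt ht⟩ = ⟨j + 1, hjn⟩ := by
    rw [Equiv.symm_apply_eq]; exact Fin.ext h₁.symm
  have e₂ : u.symm ⟨t + 1, ht⟩ = ⟨j, Nat.lt_of_succ_lt hjn⟩ := by
    rw [Equiv.symm_apply_eq]; exact Fin.ext h₂.symm
  rw [e₁, e₂, Fin.lt_def] at h
  simp at h

theorem IsLeftDescent.permDes_subset {w : Equiv.Perm (Fin n)} {t : ℕ}
    (h : IsLeftDescent w t) : permDes (adjSwap n t * w) ⊆ permDes w := by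
  simpa only [adjSwap_mul_cancel] using h.isLeftAscent.permDes_subset

theorem apply_eq_of_mem_permDes_mul {u : Equiv.Perm (Fin n)} {t j : ℕ} (ht : t + 1 < n)
    (h₁ : j + 1 ∈ permDes (adjSwap n t * u)) (h₂ : j + 1 ∉ permDes u) :
    ∃ h : j + 1 < n, (u ⟨j, Nat.lt_of_succ_lt h⟩ : ℕ) = t ∧ (u ⟨j + 1, h⟩ : ℕ) = t + 1 := by
  rw [succ_mem_permDes] at h₁ h₂
  obtain ⟨h, h₁⟩ := h₁
  rw [Equiv.Perm.mul_apply, Equiv.Perm.mul_apply, adjSwap_lt_iff ht] at h₁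
  rcases h₁ with h₁ | h₁
  · exact absurd ⟨h, h₁.1⟩ h₂
  · exact ⟨h, h₁⟩

/-- If left multiplication by a simple transposition creates a new descent, then it
coincides with a right multiplication. -/
theorem adjSwap_mul_eq_mul_adjSwap {u : Equiv.Perm (Fin n)} {t j : ℕ} (ht : t + 1 < n)
    (h₁ : j + 1 ∈ permDes (adjSwap n t * u)) (h₂ : j + 1 ∉ permDes u) :
    adjSwap n t * u = u * adjSwap n j := by
  obtain ⟨h, e₁, e₂⟩ := apply_eq_of_mem_permDes_mul ht h₁ h₂
  have e₁ : u⁻¹ ⟨t, Nat.lt_of_succ_lt ht⟩ = ⟨j, Nat.lt_of_succ_lt h⟩ := by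
    rw [Equiv.Perm.inv_eq_iff_eq]; exact Fin.ext e₁.symm
  have e₂ : u⁻¹ ⟨t + 1, ht⟩ = ⟨j + 1, h⟩ := by
    rw [Equiv.Perm.inv_eq_iff_eq]; exact Fin.ext e₂.symm
  rw [adjSwap, adjSwap, dif_pos ht, dif_pos h, Equiv.swap_mul_eq_mul_swap, e₁, e₂]

/-- `w` is minimal for the left weak order among the permutations whose descent set
contains `I`: undoing any left descent destroys a descent in `I`. -/
def IsWeakMin (I : Finset ℕ) (w : Equiv.Perm (Fin n)) : Prop :=
  I ⊆ permDes w ∧ ∀ t, IsLeftDescent w t → ¬ I ⊆ permDes (adjSwap n t * w)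

theorem IsWeakMin.symm_apply {I : Finset ℕ} {w : Equiv.Perm (Fin n)} (hw : IsWeakMin I w)
    {t : ℕ} (h : t + 1 < n)
    (hlt : w.symm ⟨t + 1, h⟩ < w.symm ⟨t, Nat.lt_of_succ_lt h⟩) :
    (w.symm ⟨t, Nat.lt_of_succ_lt h⟩ : ℕ) = w.symm ⟨t + 1, h⟩ + 1 ∧
      (w.symm ⟨t, Nat.lt_of_succ_lt h⟩ : ℕ) ∈ I := by
  obtain ⟨c, hc, hc'⟩ := Finset.not_subset.1 (hw.2 t ⟨h, hlt⟩)
  obtain ⟨j, rfl⟩ := exists_eq_succ_of_mem_permDes (hw.1 hc)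
  obtain ⟨hj, e₁, e₂⟩ := apply_eq_of_mem_permDes_mul (u := adjSwap n t * w) h
    (by rw [adjSwap_mul_cancel]; exact hw.1 hc) hc'
  have e₁ : (adjSwap n t * w) ⟨j, Nat.lt_of_succ_lt hj⟩ = ⟨t, Nat.lt_of_succ_lt h⟩ :=
    Fin.ext e₁
  have e₂ : (adjSwap n t * w) ⟨j + 1, hj⟩ = ⟨t + 1, h⟩ := Fin.ext e₂
  rw [← Equiv.eq_symm_apply, adjSwap_mul_symm_apply, adjSwap_apply_left h] at e₁
  rw [← Equiv.eq_symm_apply, adjSwap_mul_symm_apply, adjSwap_apply_right h] at e₂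
  rw [← e₁, ← e₂]
  exact ⟨rfl, hc⟩

theorem IsWeakMin.lt_iff {I : Finset ℕ} {w : Equiv.Perm (Fin n)} (hw : IsWeakMin I w)
    {a b : Fin n} (hab : a < b) :
    w b < w a ↔ ∀ c, (a : ℕ) < c → c ≤ b → c ∈ I := by
  constructor
  · intro hlt c hac hcb
    by_contra hc
    have key : ∀ v (hv : v < n), (w b : ℕ) ≤ v → v ≤ w a → c ≤ (w.symm ⟨v, hv⟩ : ℕ) := by
      intro v hv hbv
      induction v, hbv using Nat.le_induction with
      | base => intro _; simpa using hcb
      | succ v _ ih =>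
        intro hva
        have hcv := ih (by omega) (by omega)
        by_contra hlt'
        obtain ⟨h₁, h₂⟩ := hw.symm_apply hv (Fin.lt_def.2 (by omega))
        exact hc ((show (w.symm ⟨v, by omega⟩ : ℕ) = c by omega) ▸ h₂)
    have := key (w a) (w a).2 (le_of_lt hlt) le_rfl
    simp at this
    omega
  · obtain ⟨a, ha⟩ := a
    obtain ⟨b, hb⟩ := b
    simp only [Fin.mk_lt_mk] at hab
    intro h
    induction b, hab using Nat.le_induction with
    | base =>
      obtain ⟨_, h'⟩ := succ_mem_permDes.1 (hw.1 (h (a + 1) (by simp) le_rfl))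
      exact h'
    | succ b hab ih =>
      obtain ⟨_, h'⟩ := succ_mem_permDes.1
        (hw.1 (h (b + 1) (by simp only; omega) le_rfl))
      exact h'.trans (ih _ fun c hac hcb => h c hac (by simp only at hcb ⊢; omega))

theorem IsWeakMin.eq {I : Finset ℕ} {u v : Equiv.Perm (Fin n)} (hu : IsWeakMin I u)
    (hv : IsWeakMin I v) : u = v :=
  perm_eq_of_lt_iff fun _ _ hpq => by rw [hu.lt_iff hpq, hv.lt_iff hpq]

theorem isWeakMin_of_invCount_le {I : Finset ℕ} {w : Equiv.Perm (Fin n)} (hw : permDes w = I)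
    (hmin : ∀ u : Equiv.Perm (Fin n), permDes u = I → invCount w ≤ invCount u) :
    IsWeakMin I w := by
  refine ⟨hw.ge, fun t ht hI => ?_⟩
  have h₁ := hmin _ ((ht.permDes_subset.trans hw.le).antisymm hI)
  have h₂ := ht.invCount_mul
  omega

/-- A permutation that is weakly increasing on the level sets of an antitone `d` compares
values of `w` through `d`. -/
theorem symm_lt_symm_iff {d : Fin n → ℕ} (hd : Antitone d) {w : Equiv.Perm (Fin n)}
    (hw : ∀ j (h : j + 1 < n), j + 1 ∈ permDes w →
      d ⟨j + 1, h⟩ < d ⟨j, Nat.lt_of_succ_lt h⟩)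
    {k l : Fin n} (hkl : k < l) :
    w.symm k < w.symm l ↔ d (w.symm l) ≤ d (w.symm k) := by
  refine ⟨fun h => hd h.le, fun h => ?_⟩
  by_contra hc
  have hlt : w.symm l < w.symm k := lt_of_le_of_ne (not_lt.1 hc) (by simpa using hkl.ne')
  have key : ∀ p q : Fin n, p < q → d p ≤ d q → w p < w q := by
    rintro ⟨p, hp⟩ ⟨q, hq⟩ hpq
    simp only [Fin.mk_lt_mk] at hpq
    have step : ∀ j (h : j + 1 < n), d ⟨j, Nat.lt_of_succ_lt h⟩ ≤ d ⟨j + 1, h⟩ →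
        w ⟨j, Nat.lt_of_succ_lt h⟩ < w ⟨j + 1, h⟩ := by
      intro j h hdj
      by_contra hcj
      refine absurd (hw j h (succ_mem_permDes.2 ⟨h, ?_⟩)) hdj.not_gt
      exact lt_of_le_of_ne (not_lt.1 hcj) (by simp)
    induction q, hpq using Nat.le_induction with
    | base => exact step p hq
    | succ q hpq ih =>
      intro hdpq
      have h₁ : d ⟨q + 1, hq⟩ ≤ d ⟨q, Nat.lt_of_succ_lt hq⟩ := hd (by simp)
      have h₂ : d ⟨q, Nat.lt_of_succ_lt hq⟩ ≤ d ⟨p, hp⟩ :=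
        hd (by simp only [Fin.mk_le_mk]; omega)
      exact (ih _ (hdpq.trans h₁)).trans (step q hq (h₂.trans hdpq))
  have := key _ _ hlt h
  rw [Equiv.apply_symm_apply, Equiv.apply_symm_apply] at this
  exact this.asymm hkl

theorem eq_of_comp_symm_eq {d : Fin n → ℕ} (hd : Antitone d) {u v : Equiv.Perm (Fin n)}
    (hu : ∀ j (h : j + 1 < n), j + 1 ∈ permDes u →
      d ⟨j + 1, h⟩ < d ⟨j, Nat.lt_of_succ_lt h⟩)
    (hv : ∀ j (h : j + 1 < n), j + 1 ∈ permDes v →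
      d ⟨j + 1, h⟩ < d ⟨j, Nat.lt_of_succ_lt h⟩)
    (h : ∀ k, d (u.symm k) = d (v.symm k)) : u = v := by
  have : u.symm = v.symm := perm_eq_of_lt_iff fun p q hpq => by
    have h₁ := symm_lt_symm_iff hd hu hpq
    have h₂ := symm_lt_symm_iff hd hv hpq
    rw [h, h] at h₁
    have hu' : u.symm p ≠ u.symm q := by simpa using hpq.ne
    have hv' : v.symm p ≠ v.symm q := by simpa using hpq.ne
    rw [← not_iff_not, not_lt, not_lt, hu'.le_iff_lt, hv'.le_iff_lt, h₁, h₂]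
  exact Equiv.symm_bijective.injective this

end Descent

section Pibar

variable {F : Type*} [Field F] {n : ℕ}

theorem Xv_of_lt {t : ℕ} (h : t < n) : Xv F n t = X ⟨t, h⟩ := dif_pos h

theorem Xv_sub_Xv_ne_zero {s t : ℕ} (hs : s < n) (ht : t < n) (hst : s ≠ t) :
    Xv F n s - Xv F n t ≠ 0 := by
  rw [Xv_of_lt hs, Xv_of_lt ht, sub_ne_zero]
  exact fun h => hst (by simpa using X_injective h)

theorem rename_adjSwap_Xv_left {t : ℕ} (h : t + 1 < n) :
    rename (adjSwap n t) (Xv F n t) = Xv F n (t + 1) := by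
  rw [Xv_of_lt h, Xv_of_lt (Nat.lt_of_succ_lt h), rename_X, adjSwap_apply_left h]

theorem rename_adjSwap_Xv_right {t : ℕ} (h : t + 1 < n) :
    rename (adjSwap n t) (Xv F n (t + 1)) = Xv F n t := by
  rw [Xv_of_lt h, Xv_of_lt (Nat.lt_of_succ_lt h), rename_X, adjSwap_apply_right h]

theorem rename_adjSwap_Xv_of_ne {s t : ℕ} (h₁ : s ≠ t) (h₂ : s ≠ t + 1) :
    rename (adjSwap n t) (Xv F n s) = Xv F n s := by
  by_cases hs : s < n
  · rw [Xv_of_lt hs, rename_X, adjSwap_apply_of_ne h₁ h₂]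
  · simp [Xv, hs]

theorem rename_perm_mul (u v : Equiv.Perm (Fin n)) (f : MvPolynomial (Fin n) F) :
    rename u (rename v f) = rename (u * v) f := by
  rw [rename_rename, Equiv.Perm.coe_mul]

theorem rename_adjSwap_rename (t : ℕ) (f : MvPolynomial (Fin n) F) :
    rename (adjSwap n t) (rename (adjSwap n t) f) = f := by
  rw [rename_perm_mul, adjSwap_mul_self, Equiv.Perm.coe_one, rename_id_apply]

theorem PibarRel.unique {t : ℕ} (h : t + 1 < n) {f g g' : MvPolynomial (Fin n) F}
    (hg : PibarRel F n t f g) (hg' : PibarRel F n t f g') : g = g' :=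
  mul_left_cancel₀ (Xv_sub_Xv_ne_zero (Nat.lt_of_succ_lt h) h (by omega)) (hg.trans hg'.symm)

theorem Xv_sub_Xv_dvd {t : ℕ} (h : t + 1 < n) (f : MvPolynomial (Fin n) F) :
    Xv F n t - Xv F n (t + 1) ∣ f - rename (adjSwap n t) f := by
  induction f using MvPolynomial.induction_on with
  | C a => simp
  | add p q hp hq =>
    rw [map_add, add_sub_add_comm]
    exact dvd_add hp hq
  | mul_X p i hp =>
    have hX : Xv F n t - Xv F n (t + 1) ∣ X i - rename (adjSwap n t) (X i) := by
      rw [← Xv_of_lt (F := F) i.2]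
      by_cases h₁ : (i : ℕ) = t
      · rw [h₁, rename_adjSwap_Xv_left h]
      · by_cases h₂ : (i : ℕ) = t + 1
        · rw [h₂, rename_adjSwap_Xv_right h]
          exact ⟨-1, by ring⟩
        · rw [rename_adjSwap_Xv_of_ne h₁ h₂, sub_self]
          exact dvd_zero _
    have : p * X i - rename (adjSwap n t) (p * X i) =
        (p - rename (adjSwap n t) p) * X i +
          rename (adjSwap n t) p * (X i - rename (adjSwap n t) (X i)) := by
      rw [map_mul]; ring
    rw [this]
    exact dvd_add (hp.mul_right _) (hX.mul_left _)

theorem exists_pibarRel {t : ℕ} (h : t + 1 < n) (f : MvPolynomial (Fin n) F) :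
    ∃ g, PibarRel F n t f g := by
  obtain ⟨g, hg⟩ := Xv_sub_Xv_dvd h f
  exact ⟨Xv F n (t + 1) * g, by rw [PibarRel, hg]; ring⟩

variable (F n) in
/-- The operator `π̄_t` as a linear endomorphism (zero when `t` is out of range). -/
def pibar (t : ℕ) : Module.End F (MvPolynomial (Fin n) F) :=
  if h : t + 1 < n then
    { toFun := fun f => (exists_pibarRel h f).choose
      map_add' := fun f g => by
        refine (exists_pibarRel h (f + g)).choose_spec.unique h ?_
        have hf := (exists_pibarRel h f).choose_spec
        have hg := (exists_pibarRel h g).choose_spec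
        rw [PibarRel] at hf hg ⊢
        rw [mul_add, hf, hg, map_add]
        ring
      map_smul' := fun c f => by
        refine (exists_pibarRel h (c • f)).choose_spec.unique h ?_
        have hf := (exists_pibarRel h f).choose_spec
        rw [PibarRel] at hf ⊢
        rw [RingHom.id_apply, mul_smul_comm, hf, map_smul, ← smul_sub, mul_smul_comm] }
  else 0

theorem pibarRel_pibar {t : ℕ} (h : t + 1 < n) (f : MvPolynomial (Fin n) F) :
    PibarRel F n t f (pibar F n t f) := by
  rw [pibar, dif_pos h]
  exact (exists_pibarRel h f).choose_spec

theorem PibarRel.eq_pibar {t : ℕ} (h : t + 1 < n) {f g : MvPolynomial (Fin n) F}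
    (hg : PibarRel F n t f g) : g = pibar F n t f :=
  hg.unique h (pibarRel_pibar h f)

theorem pibar_eq_zero {t : ℕ} (h : t + 1 < n) {f : MvPolynomial (Fin n) F}
    (hf : rename (adjSwap n t) f = f) : pibar F n t f = 0 :=
  (PibarRel.eq_pibar h (by rw [PibarRel, hf, sub_self, mul_zero, mul_zero])).symm

theorem pibar_rename {t : ℕ} (h : t + 1 < n) (f : MvPolynomial (Fin n) F) :
    pibar F n t (rename (adjSwap n t) f) = -pibar F n t f := by
  refine (PibarRel.eq_pibar h ?_).symm
  have hf := pibarRel_pibar h f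
  rw [PibarRel] at hf ⊢
  rw [rename_adjSwap_rename, mul_neg, hf]
  ring

theorem pibar_pibar {t : ℕ} (h : t + 1 < n) (f : MvPolynomial (Fin n) F) :
    pibar F n t (pibar F n t f) = -pibar F n t f := by
  refine (PibarRel.eq_pibar h ?_).symm
  have hf := pibarRel_pibar h f
  rw [PibarRel] at hf ⊢
  have hs := congrArg (rename (adjSwap n t)) hf
  simp only [map_mul, map_sub, rename_adjSwap_Xv_left h, rename_adjSwap_Xv_right h,
    rename_adjSwap_rename] at hs
  refine mul_left_cancel₀
    (Xv_sub_Xv_ne_zero (F := F) (Nat.lt_of_succ_lt h) h (Nat.succ_ne_self t).symm) ?_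
  linear_combination (-(Xv F n t - Xv F n (t + 1)) - Xv F n (t + 1)) * hf - Xv F n (t + 1) * hs

theorem pibar_comm {i j : ℕ} (hij : i + 1 < j) (hj : j + 1 < n) :
    pibar F n i * pibar F n j = pibar F n j * pibar F n i := by
  have hi : i + 1 < n := by omega
  refine LinearMap.ext fun f => ?_
  rw [Module.End.mul_apply, Module.End.mul_apply]
  have h₁ := pibarRel_pibar hi f
  have h₂ := pibarRel_pibar hj f
  have h₃ := pibarRel_pibar hi (pibar F n j f)
  have h₄ := pibarRel_pibar hj (pibar F n i f)
  rw [PibarRel] at h₁ h₂ h₃ h₄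
  have h₅ := congrArg (rename (adjSwap n j)) h₁
  have h₆ := congrArg (rename (adjSwap n i)) h₂
  have hs : rename (adjSwap n i) (rename (adjSwap n j) f) =
      rename (adjSwap n j) (rename (adjSwap n i) f) := by
    rw [rename_perm_mul, rename_perm_mul, adjSwap_comm hij]
  simp only [map_mul, map_sub, hs, rename_adjSwap_Xv_of_ne (show i ≠ j by omega)
    (show i ≠ j + 1 by omega), rename_adjSwap_Xv_of_ne (show i + 1 ≠ j by omega)
    (show i + 1 ≠ j + 1 by omega), rename_adjSwap_Xv_of_ne (show j ≠ i by omega)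
    (show j ≠ i + 1 by omega), rename_adjSwap_Xv_of_ne (show j + 1 ≠ i by omega)
    (show j + 1 ≠ i + 1 by omega)] at h₅ h₆
  refine mul_left_cancel₀ (mul_ne_zero
    (Xv_sub_Xv_ne_zero (F := F) (Nat.lt_of_succ_lt hi) hi (Nat.succ_ne_self i).symm)
    (Xv_sub_Xv_ne_zero (F := F) (Nat.lt_of_succ_lt hj) hj (Nat.succ_ne_self j).symm)) ?_
  linear_combination (Xv F n j - Xv F n (j + 1)) * h₃ - (Xv F n i - Xv F n (i + 1)) * h₄ +
    Xv F n (i + 1) * (h₂ - h₆) - Xv F n (j + 1) * (h₁ - h₅)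

theorem pibar_braid {i : ℕ} (hi : i + 2 < n) :
    pibar F n i * pibar F n (i + 1) * pibar F n i =
      pibar F n (i + 1) * pibar F n i * pibar F n (i + 1) := by
  have h₁ : i + 1 < n := by omega
  have h₂ : i + 1 + 1 < n := hi
  have ea := rename_adjSwap_Xv_left (F := F) h₁
  have eb := rename_adjSwap_Xv_right (F := F) h₁
  have ec := rename_adjSwap_Xv_of_ne (F := F) (n := n) (s := i + 1 + 1) (t := i)
    (by omega) (by omega)
  have ea' := rename_adjSwap_Xv_of_ne (F := F) (n := n) (s := i) (t := i + 1)
    (by omega) (by omega)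
  have eb' := rename_adjSwap_Xv_left (F := F) h₂
  have ec' := rename_adjSwap_Xv_right (F := F) h₂
  refine LinearMap.ext fun f => ?_
  simp only [Module.End.mul_apply]
  have hs : rename (adjSwap n i) (rename (adjSwap n (i + 1)) (rename (adjSwap n i) f)) =
      rename (adjSwap n (i + 1)) (rename (adjSwap n i) (rename (adjSwap n (i + 1)) f)) := by
    simp only [rename_perm_mul, ← mul_assoc, adjSwap_braid hi]
  have hab := Xv_sub_Xv_ne_zero (F := F) (n := n) (s := i) (t := i + 1)
    (by omega) (by omega) (by omega)
  have hbc := Xv_sub_Xv_ne_zero (F := F) (n := n) (s := i + 1) (t := i + 1 + 1)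
    (by omega) (by omega) (by omega)
  have hac := Xv_sub_Xv_ne_zero (F := F) (n := n) (s := i) (t := i + 1 + 1)
    (by omega) (by omega) (by omega)
  -- both sides are `bc²` times the antisymmetrization of `f`, divided by the Vandermonde product
  have hl : (Xv F n i - Xv F n (i + 1)) * (Xv F n (i + 1) - Xv F n (i + 1 + 1)) *
      (Xv F n i - Xv F n (i + 1 + 1)) * pibar F n i (pibar F n (i + 1) (pibar F n i f)) =
      Xv F n (i + 1) * Xv F n (i + 1 + 1) ^ 2 *
        (f - rename (adjSwap n i) f - rename (adjSwap n (i + 1)) f +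
          rename (adjSwap n (i + 1)) (rename (adjSwap n i) f) +
          rename (adjSwap n i) (rename (adjSwap n (i + 1)) f) -
          rename (adjSwap n i) (rename (adjSwap n (i + 1)) (rename (adjSwap n i) f))) := by
    have hE := pibarRel_pibar h₁ f
    have hG := pibarRel_pibar h₂ (pibar F n i f)
    have hH := pibarRel_pibar h₁ (pibar F n (i + 1) (pibar F n i f))
    rw [PibarRel] at hE hG hH
    have hE₁ := congrArg (rename (adjSwap n i)) hE
    have hE₂ := congrArg (rename (adjSwap n (i + 1))) hE
    have hG₁ := congrArg (rename (adjSwap n i)) hG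
    simp only [map_mul, map_sub, ea, eb, ec, ea', eb', rename_adjSwap_rename]
      at hE₁ hE₂ hG₁
    have hE₂₁ := congrArg (rename (adjSwap n i)) hE₂
    simp only [map_mul, map_sub, ea, ec] at hE₂₁
    generalize Xv F n i = a at *
    generalize Xv F n (i + 1) = b at *
    generalize Xv F n (i + 1 + 1) = c at *
    refine mul_left_cancel₀ hab ?_
    linear_combination (a - b) * (b - c) * (a - c) * hH + b * (a - c) * (a - b) * hG -
      b * (b - c) * (a - b) * hG₁ + b * c * (a - c) * hE - b * c * (a - b) * hE₂ +
      b * c * (b - c) * hE₁ + b * c * (a - b) * hE₂₁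
  have hr : (Xv F n i - Xv F n (i + 1)) * (Xv F n (i + 1) - Xv F n (i + 1 + 1)) *
      (Xv F n i - Xv F n (i + 1 + 1)) *
        pibar F n (i + 1) (pibar F n i (pibar F n (i + 1) f)) =
      Xv F n (i + 1) * Xv F n (i + 1 + 1) ^ 2 *
        (f - rename (adjSwap n i) f - rename (adjSwap n (i + 1)) f +
          rename (adjSwap n (i + 1)) (rename (adjSwap n i) f) +
          rename (adjSwap n i) (rename (adjSwap n (i + 1)) f) -
          rename (adjSwap n (i + 1))
            (rename (adjSwap n i) (rename (adjSwap n (i + 1)) f))) := by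
    have hE := pibarRel_pibar h₂ f
    have hG := pibarRel_pibar h₁ (pibar F n (i + 1) f)
    have hH := pibarRel_pibar h₂ (pibar F n i (pibar F n (i + 1) f))
    rw [PibarRel] at hE hG hH
    have hE₁ := congrArg (rename (adjSwap n (i + 1))) hE
    have hE₂ := congrArg (rename (adjSwap n i)) hE
    have hG₁ := congrArg (rename (adjSwap n (i + 1))) hG
    simp only [map_mul, map_sub, eb, ec, ea', eb', ec', rename_adjSwap_rename]
      at hE₁ hE₂ hG₁
    have hE₂₁ := congrArg (rename (adjSwap n (i + 1))) hE₂
    simp only [map_mul, map_sub, ea', ec'] at hE₂₁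
    generalize Xv F n i = a at *
    generalize Xv F n (i + 1) = b at *
    generalize Xv F n (i + 1 + 1) = c at *
    refine mul_left_cancel₀ hbc ?_
    linear_combination (a - b) * (b - c) * (a - c) * hH + c * (a - c) * (b - c) * hG -
      c * (a - b) * (b - c) * hG₁ + b * c * (a - c) * hE - b * c * (b - c) * hE₂ +
      c ^ 2 * (a - b) * hE₁ + c ^ 2 * (b - c) * hE₂₁
  rw [hs] at hl
  exact mul_left_cancel₀ (mul_ne_zero (mul_ne_zero hab hbc) hac) (hl.trans hr.symm)

theorem prod_map_pibar_eq {L L' : List ℕ} {w : Equiv.Perm (Fin n)}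
    (hL : IsReducedWord n L w) (hL' : IsReducedWord n L' w) :
    (L.map (pibar F n)).prod = (L'.map (pibar F n)).prod :=
  prod_map_eq_of_isReducedWord _ (fun _ _ hij hj => pibar_comm hij hj)
    (fun _ hi => pibar_braid hi) hL hL'

theorem PibarChain.apply_length {L : List ℕ} (hL : ∀ t ∈ L, t + 1 < n)
    {g : ℕ → MvPolynomial (Fin n) F} (hg : PibarChain F n L g) :
    g L.length = (L.map (pibar F n)).prod (g 0) := by
  induction L with
  | nil => simp
  | cons t L ih =>
    have h₁ := ih (fun s hs => hL s (by simp [hs])) fun s hs => by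
      have := hg s (by simp only [List.length_cons]; omega)
      rwa [List.reverse_cons, List.getD_append _ _ _ _ (by simpa using hs)] at this
    have h₂ := hg L.length (by simp)
    rw [List.reverse_cons, List.getD_append_right _ _ _ _ (by simp)] at h₂
    simp only [List.length_reverse, Nat.sub_self, List.getD_cons_zero] at h₂
    rw [List.map_cons, List.prod_cons, Module.End.mul_apply, ← h₁]
    exact h₂.eq_pibar (hL t (by simp))

theorem IsPibarApplied.eq {w : Equiv.Perm (Fin n)} {f p : MvPolynomial (Fin n) F}
    (hp : IsPibarApplied F n w f p) {L : List ℕ} (hL : IsReducedWord n L w) :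
    p = (L.map (pibar F n)).prod f := by
  obtain ⟨L', g, hL', rfl, hg, rfl⟩ := hp
  rw [hg.apply_length hL'.1, prod_map_pibar_eq hL' hL]

end Pibar

section LeadingTerm

variable {F : Type*} [Field F] {n : ℕ}

/-- The sum of the squares of the entries of an exponent vector. -/
def sqNorm (e : Fin n →₀ ℕ) : ℕ := ∑ k, e k ^ 2

theorem sqNorm_add_single_add_single {i j : Fin n} (hij : i ≠ j) {r : Fin n →₀ ℕ}
    (hi : r i = 0) (hj : r j = 0) (p q : ℕ) :
    sqNorm (r + Finsupp.single i p + Finsupp.single j q) = sqNorm r + p ^ 2 + q ^ 2 := by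
  have : ∀ k, (r + Finsupp.single i p + Finsupp.single j q) k ^ 2 =
      r k ^ 2 + (if i = k then p ^ 2 else 0) + (if j = k then q ^ 2 else 0) := by
    intro k
    simp only [Finsupp.add_apply, Finsupp.single_apply]
    split_ifs <;> simp_all
  simp only [sqNorm, this, Finset.sum_add_distrib, Finset.sum_ite_eq, Finset.mem_univ, if_true]

theorem exists_eq_add_single_add_single {i j : Fin n} (hij : i ≠ j) (e : Fin n →₀ ℕ) :
    ∃ r : Fin n →₀ ℕ, r i = 0 ∧ r j = 0 ∧
      e = r + Finsupp.single i (e i) + Finsupp.single j (e j) := by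
  refine ⟨(e.erase i).erase j, by simp [hij], by simp, ?_⟩
  ext k
  rcases eq_or_ne k j with rfl | hkj
  · simp [hij]
  · rcases eq_or_ne k i with rfl | hki
    · simp [hij]
    · simp [hki, hkj]

/-- The exponent vector of the monomial obtained from `x^d` by relabelling the variables
according to `w`. -/
def permExp (d : Fin n → ℕ) (w : Equiv.Perm (Fin n)) : Fin n →₀ ℕ :=
  Finsupp.equivFunOnFinite.symm fun k => d (w.symm k)

theorem permExp_apply (d : Fin n → ℕ) (w : Equiv.Perm (Fin n)) (k : Fin n) :
    permExp d w k = d (w.symm k) := rfl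

theorem rename_monomial_permExp (d : Fin n → ℕ) (u w : Equiv.Perm (Fin n)) (c : F) :
    rename u (monomial (permExp d w) c) = monomial (permExp d (u * w)) c := by
  have h : Finsupp.equivMapDomain u (permExp d w) = permExp d (u * w) := by
    ext k
    rw [Finsupp.equivMapDomain_apply, permExp_apply, permExp_apply]
    rfl
  rw [rename_monomial, ← Finsupp.equivMapDomain_eq_mapDomain, h]

theorem sqNorm_permExp (d : Fin n → ℕ) (u w : Equiv.Perm (Fin n)) :
    sqNorm (permExp d u) = sqNorm (permExp d w) := by
  simp only [sqNorm, permExp_apply]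
  rw [Equiv.sum_comp u.symm fun k => d k ^ 2, Equiv.sum_comp w.symm fun k => d k ^ 2]

theorem prod_X_pow_eq_monomial_permExp (d : Fin n → ℕ) :
    (∏ j, X j ^ d j : MvPolynomial (Fin n) F) = monomial (permExp d 1) 1 := by
  rw [monomial_eq, C_1, one_mul, Finsupp.prod_fintype _ _ (by simp)]
  rfl

theorem rename_adjSwap_monomial {t : ℕ} (h : t + 1 < n) {r : Fin n →₀ ℕ}
    (h₁ : r ⟨t, Nat.lt_of_succ_lt h⟩ = 0) (h₂ : r ⟨t + 1, h⟩ = 0) (p q : ℕ) :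
    rename (adjSwap n t) (monomial (r + Finsupp.single ⟨t, Nat.lt_of_succ_lt h⟩ p +
      Finsupp.single ⟨t + 1, h⟩ q) (1 : F)) =
    monomial (r + Finsupp.single ⟨t, Nat.lt_of_succ_lt h⟩ q +
      Finsupp.single ⟨t + 1, h⟩ p) 1 := by
  have hr : Finsupp.mapDomain (adjSwap n t) r = r := by
    rw [← Finsupp.equivMapDomain_eq_mapDomain]
    ext k
    rw [Finsupp.equivMapDomain_apply, ← Equiv.Perm.inv_def, adjSwap_inv]
    by_cases hk₁ : (k : ℕ) = t
    · obtain rfl : k = ⟨t, Nat.lt_of_succ_lt h⟩ := Fin.ext hk₁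
      rw [adjSwap_apply_left h, h₁, h₂]
    · by_cases hk₂ : (k : ℕ) = t + 1
      · obtain rfl : k = ⟨t + 1, h⟩ := Fin.ext hk₂
        rw [adjSwap_apply_right h, h₁, h₂]
      · rw [adjSwap_apply_of_ne hk₁ hk₂]
  rw [rename_monomial, Finsupp.mapDomain_add, Finsupp.mapDomain_add, hr,
    Finsupp.mapDomain_single, Finsupp.mapDomain_single, adjSwap_apply_left h,
    adjSwap_apply_right h, add_right_comm]

theorem pibar_monomial {t : ℕ} (h : t + 1 < n) {r : Fin n →₀ ℕ}
    (h₁ : r ⟨t, Nat.lt_of_succ_lt h⟩ = 0) (h₂ : r ⟨t + 1, h⟩ = 0) (q c : ℕ) :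
    pibar F n t (monomial (r + Finsupp.single ⟨t, Nat.lt_of_succ_lt h⟩ (q + c) +
      Finsupp.single ⟨t + 1, h⟩ q) 1) =
    ∑ j ∈ Finset.range c, monomial (r + Finsupp.single ⟨t, Nat.lt_of_succ_lt h⟩ (q + j) +
      Finsupp.single ⟨t + 1, h⟩ (q + c - j)) 1 := by
  have hm : ∀ a b : ℕ, monomial (r + Finsupp.single ⟨t, Nat.lt_of_succ_lt h⟩ a +
      Finsupp.single ⟨t + 1, h⟩ b) (1 : F) =
      monomial r 1 * X ⟨t, Nat.lt_of_succ_lt h⟩ ^ a * X ⟨t + 1, h⟩ ^ b := by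
    intro a b
    simp [X_pow_eq_monomial, monomial_mul]
  refine (PibarRel.eq_pibar h ?_).symm
  rw [PibarRel, rename_adjSwap_monomial h h₁ h₂, Xv_of_lt h, Xv_of_lt (Nat.lt_of_succ_lt h)]
  simp only [hm]
  generalize (X ⟨t, Nat.lt_of_succ_lt h⟩ : MvPolynomial (Fin n) F) = x
  generalize (X ⟨t + 1, h⟩ : MvPolynomial (Fin n) F) = y
  generalize (monomial r 1 : MvPolynomial (Fin n) F) = m
  have hsum : ∑ j ∈ Finset.range c, m * x ^ (q + j) * y ^ (q + c - j) =
      m * x ^ q * y ^ (q + 1) * ∑ j ∈ Finset.range c, x ^ j * y ^ (c - 1 - j) := by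
    rw [Finset.mul_sum]
    refine Finset.sum_congr rfl fun j hj => ?_
    rw [show q + c - j = (q + 1) + (c - 1 - j) by have := Finset.mem_range.1 hj; omega]
    ring
  rw [hsum]
  linear_combination m * x ^ q * y ^ (q + 1) * geom_sum₂_mul x y c

variable (F) in
/-- The polynomials all of whose exponent vectors have `sqNorm` less than `N`. -/
def lowerTerms (n N : ℕ) : Submodule F (MvPolynomial (Fin n) F) :=
  restrictSupport F {e | sqNorm e < N}

theorem monomial_mem_lowerTerms {e : Fin n →₀ ℕ} {N : ℕ} (h : sqNorm e < N) (c : F) :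
    monomial e c ∈ lowerTerms F n N :=
  (monomial_mem_restrictSupport F).2 (Or.inl h)

theorem coeff_eq_zero_of_mem_lowerTerms {f : MvPolynomial (Fin n) F} {N : ℕ}
    (hf : f ∈ lowerTerms F n N) {e : Fin n →₀ ℕ} (he : N ≤ sqNorm e) : coeff e f = 0 := by
  by_contra hc
  exact ((mem_restrictSupport_iff F).1 hf (mem_support_iff.2 hc)).not_ge he

theorem sq_add_sq_lt {q c j : ℕ} (hj : 0 < j) (hjc : j < c) :
    (q + j) ^ 2 + (q + c - j) ^ 2 < (q + c) ^ 2 + q ^ 2 := by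
  obtain ⟨k, rfl⟩ := Nat.exists_eq_add_of_lt hjc
  rw [show q + (j + k + 1) - j = q + (k + 1) by omega]
  nlinarith [Nat.mul_pos hj (Nat.succ_pos k)]

theorem pibar_monomial_mem {t : ℕ} (h : t + 1 < n) {e : Fin n →₀ ℕ} {N : ℕ}
    (he : sqNorm e < N) : pibar F n t (monomial e 1) ∈ lowerTerms F n N := by
  have hne : (⟨t, Nat.lt_of_succ_lt h⟩ : Fin n) ≠ ⟨t + 1, h⟩ := by simp
  have key : ∀ r : Fin n →₀ ℕ, r ⟨t, Nat.lt_of_succ_lt h⟩ = 0 → r ⟨t + 1, h⟩ = 0 →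
      ∀ q c, sqNorm r + (q + c) ^ 2 + q ^ 2 < N →
      pibar F n t (monomial (r + Finsupp.single ⟨t, Nat.lt_of_succ_lt h⟩ (q + c) +
        Finsupp.single ⟨t + 1, h⟩ q) 1) ∈ lowerTerms F n N := by
    intro r h₁ h₂ q c hN
    rw [pibar_monomial h h₁ h₂]
    refine Submodule.sum_mem _ fun j hj => monomial_mem_lowerTerms ?_ _
    rw [sqNorm_add_single_add_single hne h₁ h₂]
    rcases Nat.eq_zero_or_pos j with rfl | hj₀
    · simp only [add_zero, Nat.sub_zero]
      omega
    · have := sq_add_sq_lt (q := q) hj₀ (Finset.mem_range.1 hj)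
      omega
  obtain ⟨r, h₁, h₂, hr⟩ := exists_eq_add_single_add_single hne e
  generalize e ⟨t, Nat.lt_of_succ_lt h⟩ = p at hr
  generalize e ⟨t + 1, h⟩ = q at hr
  subst hr
  rw [sqNorm_add_single_add_single hne h₁ h₂] at he
  rcases le_total q p with hpq | hpq
  · obtain ⟨c, rfl⟩ := Nat.exists_eq_add_of_le hpq
    exact key r h₁ h₂ q c he
  · obtain ⟨c, rfl⟩ := Nat.exists_eq_add_of_le hpq
    rw [← rename_adjSwap_monomial h h₁ h₂, pibar_rename h]
    exact Submodule.neg_mem _ (key r h₁ h₂ p c (by omega))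

theorem pibar_mem_lowerTerms {t : ℕ} (h : t + 1 < n) {N : ℕ} {f : MvPolynomial (Fin n) F}
    (hf : f ∈ lowerTerms F n N) : pibar F n t f ∈ lowerTerms F n N := by
  have : lowerTerms F n N ≤ (lowerTerms F n N).comap (pibar F n t) := by
    conv_lhs => rw [lowerTerms, restrictSupport_eq_span]
    rw [Submodule.span_le]
    rintro _ ⟨e, he, rfl⟩
    exact pibar_monomial_mem h he
  exact this hf

theorem pibar_monomial_sub_rename_mem {t : ℕ} (h : t + 1 < n) {e : Fin n →₀ ℕ}
    (he : e ⟨t + 1, h⟩ < e ⟨t, Nat.lt_of_succ_lt h⟩) :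
    pibar F n t (monomial e 1) - rename (adjSwap n t) (monomial e 1) ∈
      lowerTerms F n (sqNorm e) := by
  have hne : (⟨t, Nat.lt_of_succ_lt h⟩ : Fin n) ≠ ⟨t + 1, h⟩ := by simp
  obtain ⟨r, h₁, h₂, hr⟩ := exists_eq_add_single_add_single hne e
  generalize e ⟨t, Nat.lt_of_succ_lt h⟩ = p at hr he
  generalize e ⟨t + 1, h⟩ = q at hr he
  subst hr
  obtain ⟨c, rfl⟩ := Nat.exists_eq_add_of_lt he
  rw [add_assoc q c 1, pibar_monomial h h₁ h₂, rename_adjSwap_monomial h h₁ h₂,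
    Finset.sum_range_succ']
  simp only [add_zero, Nat.sub_zero, add_sub_cancel_right]
  refine Submodule.sum_mem _ fun j hj => monomial_mem_lowerTerms ?_ _
  rw [sqNorm_add_single_add_single hne h₁ h₂, sqNorm_add_single_add_single hne h₁ h₂]
  have := sq_add_sq_lt (q := q) (c := c + 1) (j := j + 1) (Nat.succ_pos j)
    (by have := Finset.mem_range.1 hj; omega)
  omega

/-- Along a reduced word of `w`, the `π̄` operators send `x^d` to `x^{w d}` modulo terms of
smaller `sqNorm`, provided that `d` drops at every descent of `w`. -/
theorem prod_map_pibar_sub_monomial_mem {d : Fin n → ℕ} (hd : Antitone d) {L : List ℕ}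
    {w : Equiv.Perm (Fin n)} (hL : IsReducedWord n L w)
    (hw : ∀ j (h : j + 1 < n), j + 1 ∈ permDes w →
      d ⟨j + 1, h⟩ < d ⟨j, Nat.lt_of_succ_lt h⟩) :
    (L.map (pibar F n)).prod (monomial (permExp d 1) 1) - monomial (permExp d w) 1 ∈
      lowerTerms F n (sqNorm (permExp d 1)) := by
  induction L generalizing w with
  | nil =>
    obtain rfl : 1 = w := hL.2.1
    simp
  | cons t L ih =>
    obtain ⟨⟨ht, hlt⟩, hL'⟩ := hL.of_cons
    have hdes : IsLeftDescent w t := ⟨ht, hlt⟩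
    have h₁ := pibar_mem_lowerTerms ht
      (ih hL' fun j h hj => hw j h (hdes.permDes_subset hj))
    have h₂ := pibar_monomial_sub_rename_mem (F := F) (e := permExp d (adjSwap n t * w)) ht (by
      rw [permExp_apply, permExp_apply, adjSwap_mul_symm_apply, adjSwap_mul_symm_apply,
        adjSwap_apply_left ht, adjSwap_apply_right ht]
      exact not_le.1 fun hc => hlt.asymm ((symm_lt_symm_iff hd hw (by simp)).2 hc))
    rw [rename_monomial_permExp, adjSwap_mul_cancel, sqNorm_permExp d _ 1] at h₂
    have h₃ := Submodule.add_mem _ h₁ h₂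
    rwa [map_sub, sub_add_sub_cancel, ← Module.End.mul_apply, ← List.prod_cons,
      ← List.map_cons] at h₃

theorem coeff_prod_map_pibar {d : Fin n → ℕ} (hd : Antitone d) {L : List ℕ}
    {v w : Equiv.Perm (Fin n)} (hL : IsReducedWord n L w)
    (hv : ∀ j (h : j + 1 < n), j + 1 ∈ permDes v →
      d ⟨j + 1, h⟩ < d ⟨j, Nat.lt_of_succ_lt h⟩)
    (hw : ∀ j (h : j + 1 < n), j + 1 ∈ permDes w →
      d ⟨j + 1, h⟩ < d ⟨j, Nat.lt_of_succ_lt h⟩) :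
    coeff (permExp d v) ((L.map (pibar F n)).prod (monomial (permExp d 1) 1)) =
      if w = v then 1 else 0 := by
  have h₁ := coeff_eq_zero_of_mem_lowerTerms (prod_map_pibar_sub_monomial_mem (F := F) hd hL hw)
    (sqNorm_permExp d 1 v).le
  rw [coeff_sub, sub_eq_zero, coeff_monomial] at h₁
  rw [h₁]
  refine if_congr ⟨fun h => ?_, fun h => h ▸ rfl⟩ rfl rfl
  exact eq_of_comp_symm_eq hd hw hv fun k => DFunLike.congr_fun h k

end LeadingTerm

/-- Let `d_1 ≥ ⋯ ≥ d_n ≥ 0` and let `α ⪯ β` be compositions of `n`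
with `Des(β) = Des(d)`. Let `w_0(α)` be the minimal-length permutation with descent set
`Des(α)`, and let `P w = π̄_w(x^d)` (computed along any reduced word; the result is
independent of the word). Then `{π̄_w(x^d) : Des(α) ⊆ Des(w) ⊆ Des(β)}` is linearly
independent over `F`, and its span is the smallest `F`-subspace of `F[x_1,…,x_n]`
containing `π̄_{w_0(α)}(x^d)` and closed under all the operators `π̄_1, …, π̄_{n-1}`. -/
theorem pibar_module_basis (F : Type*) [Field F] (n : ℕ) (d : Fin n → ℕ)
    (hd : Antitone d) (α β : List ℕ)
    (hα : IsComposition n α) (hβ : IsComposition n β)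
    (hab : desComp α ⊆ desComp β)
    (hβd : desComp β = seqDes n fun t => if h : t < n then d ⟨t, h⟩ else 0)
    (w0 : Equiv.Perm (Fin n)) (hw0 : permDes w0 = desComp α)
    (hw0min : ∀ u : Equiv.Perm (Fin n), permDes u = desComp α →
      invCount w0 ≤ invCount u)
    (P : Equiv.Perm (Fin n) → MvPolynomial (Fin n) F)
    (hP : ∀ u : Equiv.Perm (Fin n), desComp α ⊆ permDes u → permDes u ⊆ desComp β →
      IsPibarApplied F n u (∏ j, MvPolynomial.X j ^ d j) (P u)) :
    LinearIndependent F
      (fun u : {u : Equiv.Perm (Fin n) //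
          desComp α ⊆ permDes u ∧ permDes u ⊆ desComp β} => P u.1) ∧
    Submodule.span F
      (Set.range (fun u : {u : Equiv.Perm (Fin n) //
          desComp α ⊆ permDes u ∧ permDes u ⊆ desComp β} => P u.1)) =
    sInf {V : Submodule F (MvPolynomial (Fin n) F) |
      P w0 ∈ V ∧ ∀ (t : ℕ), t + 1 < n → ∀ f ∈ V,
        ∀ g : MvPolynomial (Fin n) F, PibarRel F n t f g → g ∈ V} := by
  set xd : MvPolynomial (Fin n) F := ∏ j, X j ^ d j with hxd
  rw [seqDes] at hβd
  have hmem : ∀ j, j + 1 ∈ desComp β ↔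
      ∃ h : j + 1 < n, d ⟨j + 1, h⟩ < d ⟨j, Nat.lt_of_succ_lt h⟩ := by
    intro j
    rw [hβd, Finset.mem_filter, Finset.mem_Ico]
    simp only [Nat.add_sub_cancel]
    constructor
    · rintro ⟨⟨-, h⟩, hlt⟩
      exact ⟨h, by simpa [h, Nat.lt_of_succ_lt h] using hlt⟩
    · rintro ⟨h, hlt⟩
      exact ⟨⟨by omega, h⟩, by simpa [h, Nat.lt_of_succ_lt h] using hlt⟩
  have hdrop : ∀ u : Equiv.Perm (Fin n), permDes u ⊆ desComp β →
      ∀ j (h : j + 1 < n), j + 1 ∈ permDes u →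
        d ⟨j + 1, h⟩ < d ⟨j, Nat.lt_of_succ_lt h⟩ := fun u hu j h hj =>
    ((hmem j).1 (hu hj)).2
  have hPw : ∀ u : Equiv.Perm (Fin n), desComp α ⊆ permDes u → permDes u ⊆ desComp β →
      ∀ L, IsReducedWord n L u → P u = (L.map (pibar F n)).prod xd :=
    fun u h₁ h₂ L hL => (hP u h₁ h₂).eq hL
  have hmin : IsWeakMin (desComp α) w0 := isWeakMin_of_invCount_le hw0 hw0min
  refine ⟨?_, le_antisymm ?_ ?_⟩
  · rw [Fintype.linearIndependent_iff]
    intro c hc v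
    have h₁ := congrArg (coeff (permExp d v.1)) hc
    rw [coeff_sum, coeff_zero] at h₁
    rw [← h₁, Finset.sum_eq_single v]
    · obtain ⟨L, hL⟩ := exists_isReducedWord v.1
      rw [coeff_smul, hPw v.1 v.2.1 v.2.2 L hL, hxd, prod_X_pow_eq_monomial_permExp,
        coeff_prod_map_pibar hd hL (hdrop _ v.2.2) (hdrop _ v.2.2), if_pos rfl, smul_eq_mul,
        mul_one]
    · intro u _ huv
      obtain ⟨L, hL⟩ := exists_isReducedWord u.1
      rw [coeff_smul, hPw u.1 u.2.1 u.2.2 L hL, hxd, prod_X_pow_eq_monomial_permExp,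
        coeff_prod_map_pibar hd hL (hdrop _ v.2.2) (hdrop _ u.2.2),
        if_neg fun h => huv (Subtype.ext h), smul_zero]
    · simp
  · refine le_sInf fun V hV => ?_
    obtain ⟨hV₀, hV⟩ := hV
    rw [Submodule.span_le]
    rintro _ ⟨⟨u, hu₁, hu₂⟩, rfl⟩
    simp only [SetLike.mem_coe]
    induction hk : invCount u using Nat.strong_induction_on generalizing u with
    | _ k ih =>
    by_cases hu : IsWeakMin (desComp α) u
    · rwa [hu.eq hmin]
    · have : ∃ t, IsLeftDescent u t ∧ desComp α ⊆ permDes (adjSwap n t * u) := by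
        by_contra! hc
        exact hu ⟨hu₁, hc⟩
      obtain ⟨t, ht, hαt⟩ := this
      have hβt := ht.permDes_subset.trans hu₂
      obtain ⟨L, hL, hL'⟩ := ht.exists_isReducedWord
      have h₁ := ih _ (by have := ht.invCount_mul; omega) _ hαt hβt rfl
      have h₂ := hV t ht.1 _ h₁ _ (pibarRel_pibar ht.1 _)
      rwa [hPw _ hαt hβt L hL, ← Module.End.mul_apply, ← List.prod_cons, ← List.map_cons,
        ← hPw u hu₁ hu₂ _ hL'] at h₂
  · refine sInf_le ⟨Submodule.subset_span ⟨⟨w0, hw0.ge, hw0.le.trans hab⟩, rfl⟩, ?_⟩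
    intro t ht f hf g hg
    rw [hg.eq_pibar ht]
    refine Submodule.span_le (p := Submodule.comap (pibar F n t) (Submodule.span F _)).2 ?_ hf
    rintro _ ⟨⟨u, hu₁, hu₂⟩, rfl⟩
    simp only [SetLike.mem_coe, Submodule.mem_comap]
    rcases isLeftAscent_or_isLeftDescent u ht with hu | hu
    · obtain ⟨L, hL⟩ := exists_isReducedWord u
      have htL := hL.cons hu
      have hcons : pibar F n t (P u) = ((t :: L).map (pibar F n)).prod xd := by
        rw [hPw u hu₁ hu₂ L hL, List.map_cons, List.prod_cons, Module.End.mul_apply]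
      rw [hcons]
      by_cases hw : permDes (adjSwap n t * u) ⊆ desComp β
      · have hw' := hu₁.trans hu.permDes_subset
        rw [← hPw _ hw' hw _ htL]
        exact Submodule.subset_span ⟨⟨_, hw', hw⟩, rfl⟩
      · obtain ⟨c, hc, hcβ⟩ := Finset.not_subset.1 hw
        obtain ⟨j, rfl⟩ := exists_eq_succ_of_mem_permDes hc
        have hj : j + 1 < n := (succ_mem_permDes.1 hc).1
        have hLj : IsReducedWord n (L ++ [j]) (adjSwap n t * u) := by
          have h₁ := isReducedWord_iff.1 hL
          have h₂ := isReducedWord_iff.1 htL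
          refine isReducedWord_iff.2 ⟨?_, ?_, ?_⟩
          · intro s hs
            rcases List.mem_append.1 hs with hs | hs
            · exact h₁.1 s hs
            · rwa [List.mem_singleton.1 hs]
          · rw [adjSwap_mul_eq_mul_adjSwap ht hc fun h => hcβ (hu₂ h), ← h₁.2.1]
            simp [wordPerm]
          · rw [← h₂.2.2]
            simp
        have hdj : d ⟨j + 1, hj⟩ = d ⟨j, Nat.lt_of_succ_lt hj⟩ :=
          le_antisymm (hd (by simp)) (not_lt.1 fun h => hcβ ((hmem j).2 ⟨hj, h⟩))
        have hx : rename (adjSwap n j) xd = xd := by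
          have he : permExp d (adjSwap n j * 1) = permExp d 1 := by
            ext k
            rw [permExp_apply, permExp_apply, adjSwap_mul_symm_apply]
            by_cases hk₁ : (k : ℕ) = j
            · obtain rfl : k = ⟨j, Nat.lt_of_succ_lt hj⟩ := Fin.ext hk₁
              rw [adjSwap_apply_left hj]
              exact hdj
            · by_cases hk₂ : (k : ℕ) = j + 1
              · obtain rfl : k = ⟨j + 1, hj⟩ := Fin.ext hk₂
                rw [adjSwap_apply_right hj]
                exact hdj.symm
              · rw [adjSwap_apply_of_ne hk₁ hk₂]
          rw [hxd, prod_X_pow_eq_monomial_permExp, rename_monomial_permExp, he]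
        rw [prod_map_pibar_eq htL hLj, List.map_append, List.prod_append,
          Module.End.mul_apply]
        simp [pibar_eq_zero hj hx]
    · obtain ⟨L, -, hL⟩ := hu.exists_isReducedWord
      have h₁ := hPw u hu₁ hu₂ _ hL
      rw [List.map_cons, List.prod_cons, Module.End.mul_apply] at h₁
      have h₂ : pibar F n t (P u) = -P u := by rw [h₁, pibar_pibar ht]
      rw [h₂]
      exact Submodule.neg_mem _ (Submodule.subset_span ⟨⟨u, hu₁, hu₂⟩, rfl⟩)

end OSPHecke
end
end
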